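/- Let m ≥ 3, let Ω ⊆ ℝ^m be a domain, F⃗ a C¹ vector field on Ω, and u, v C² functions on Ω with v ≥ u in Ω and v = u at a point p₀ ∈ Ω. Suppose Ω ∩ S_F(u) = {p₀}, the (m−1)-dimensional Hausdorff measure of the closure of S_F(v) is zero, and for some real constants a^{jk} with a^{jk} + a^{kj} = 0 the function div F⃗^b is strictly positive in Ω (or strictly negative in Ω), where F⃗^b := (Σ_k a^{1k}F_k, ..., Σ_k a^{mk}F_k). Assume H_F(v) ≤ H_F(u) in Ω \ ({p₀} ∪ S_F(v)), and that for each point p ∈ Ω \ {p₀} there is a neighborhood U of p on which there exists a C^∞ orthonormal frame N₁^⊥(u),...,N_{m−1}^⊥(u) of the orthogonal complement of N_F(u) such that the rank of £(N₁^⊥(u),...,N_{m−1}^⊥(u)) is constantly m on U. Then v ≡ u in Ω. (The same conclusion holds with the roles of u and v in the singular-set and frame hypotheses interchanged.) -/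

import Mathlib

open Set Finset MeasureTheory

noncomputable section

/-- The `k`-th standard basis vector of `ℝ^N` (zero if `k ≥ N`). -/
def ee (N k : ℕ) : Fin N → ℝ := fun i => if (i : ℕ) = k then 1 else 0

/-- The `k`-th partial derivative. -/
def pd (N k : ℕ) (f : (Fin N → ℝ) → ℝ) (x : Fin N → ℝ) : ℝ := fderiv ℝ f x (ee N k)

/-- `∇u + F`. -/
def gradF (N : ℕ) (F : (Fin N → ℝ) → (Fin N → ℝ)) (u : (Fin N → ℝ) → ℝ)
    (x : Fin N → ℝ) : Fin N → ℝ :=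
  fun i => pd N i u x + F x i

/-- The Legendrian (horizontal) normal `N_F(u) = (∇u + F)/|∇u + F|`. -/
def legN (N : ℕ) (F : (Fin N → ℝ) → (Fin N → ℝ)) (u : (Fin N → ℝ) → ℝ)
    (x : Fin N → ℝ) : Fin N → ℝ :=
  fun i => gradF N F u x i / Real.sqrt (∑ k, (gradF N F u x k) ^ 2)

/-- The horizontal (p-)mean curvature `H_F(u) = div N_F(u)`. -/
def Hmc (N : ℕ) (F : (Fin N → ℝ) → (Fin N → ℝ)) (u : (Fin N → ℝ) → ℝ)
    (x : Fin N → ℝ) : ℝ :=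
  ∑ i : Fin N, pd N (i : ℕ) (fun y => legN N F u y i) x

/-- The singular set `S_F(u) ∩ Ω = {x ∈ Ω | ∇u(x) + F(x) = 0}`. -/
def SingSet (N : ℕ) (Ω : Set (Fin N → ℝ)) (F : (Fin N → ℝ) → (Fin N → ℝ))
    (u : (Fin N → ℝ) → ℝ) : Set (Fin N → ℝ) :=
  {x ∈ Ω | gradF N F u x = 0}

/-- The divergence of `F^b` for an antisymmetric constant matrix `A`. -/
def divFb (N : ℕ) (A : Matrix (Fin N) (Fin N) ℝ) (F : (Fin N → ℝ) → (Fin N → ℝ))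
    (x : Fin N → ℝ) : ℝ :=
  ∑ j : Fin N, pd N (j : ℕ) (fun y => ∑ k, A j k * F y k) x

/-- Derivative of `f` along the vector field `X`. -/
def vApp {N : ℕ} (X : (Fin N → ℝ) → (Fin N → ℝ)) (f : (Fin N → ℝ) → ℝ) (x : Fin N → ℝ) : ℝ :=
  fderiv ℝ f x (X x)

/-- Lie bracket of vector fields. -/
def lieBr {N : ℕ} (X Y : (Fin N → ℝ) → (Fin N → ℝ)) : (Fin N → ℝ) → (Fin N → ℝ) :=
  fun x => fderiv ℝ Y x (X x) - fderiv ℝ X x (Y x)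

/-- `£(S)`: the smallest `C^∞`-module of vector fields containing `S`
and closed under Lie bracket. -/
inductive LieSpan {N : ℕ} (Ω : Set (Fin N → ℝ)) (S : Set ((Fin N → ℝ) → (Fin N → ℝ))) :
    ((Fin N → ℝ) → (Fin N → ℝ)) → Prop
  | base : ∀ X ∈ S, LieSpan Ω S X
  | smul : ∀ (f : (Fin N → ℝ) → ℝ) (X : (Fin N → ℝ) → (Fin N → ℝ)),
      ContDiffOn ℝ (⊤ : ℕ∞) f Ω → LieSpan Ω S X → LieSpan Ω S (fun x => f x • X x)
  | add : ∀ X Y, LieSpan Ω S X → LieSpan Ω S Y → LieSpan Ω S (fun x => X x + Y x)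
  | bracket : ∀ X Y, LieSpan Ω S X → LieSpan Ω S Y → LieSpan Ω S (lieBr X Y)

/-- On `U` there is a smooth orthonormal frame of the orthogonal complement of
`N_F(w)` whose Lie span has full rank `m` everywhere on `U`. -/
def GoodFrame (m : ℕ) (U : Set (Fin m → ℝ)) (F : (Fin m → ℝ) → (Fin m → ℝ))
    (w : (Fin m → ℝ) → ℝ) : Prop :=
  ∃ Nw : Fin (m - 1) → ((Fin m → ℝ) → (Fin m → ℝ)),
    (∀ α, ContDiffOn ℝ (⊤ : ℕ∞) (Nw α) U) ∧
    (∀ x ∈ U, ∀ α β, (∑ i, Nw α x i * Nw β x i) = if α = β then 1 else 0) ∧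
    (∀ x ∈ U, ∀ α, (∑ i, Nw α x i * legN m F w x i) = 0) ∧
    (∀ x ∈ U, Submodule.span ℝ {v | ∃ Z, LieSpan U (Set.range Nw) Z ∧ Z x = v} = ⊤)

section

open Metric Topology Asymptotics Filter
open scoped NNReal

lemma exists_integralCurve_in_closedBall {E : Type*} [NormedAddCommGroup E] [NormedSpace ℝ E]
    [CompleteSpace E] {X : E → E} {x₀ x : E} {a : ℝ} {L K : ℝ≥0}
    (hb : ∀ y ∈ closedBall x₀ a, ‖X y‖ ≤ L) (hl : LipschitzOnWith K X (closedBall x₀ a))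
    (hx : x ∈ closedBall x₀ (a / 2)) {s : ℝ} (hs : 0 ≤ s) (hLs : L * s ≤ a / 2) :
    ∃ γ : ℝ → E, γ 0 = x ∧ ∀ t ∈ Icc 0 s, γ t ∈ closedBall x₀ a ∧
      HasDerivWithinAt γ (X (γ t)) (Icc 0 s) t := by
  have ha : 0 ≤ a := by
    have := nonneg_of_mem_closedBall hx
    linarith
  have hpl : IsPicardLindelof (fun _ => X) (tmin := 0) (tmax := s) ⟨0, Set.left_mem_Icc.2 hs⟩ x₀
      (.mk a ha) (.mk (a / 2) (by positivity)) L K := by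
    apply IsPicardLindelof.of_time_independent
    · exact hb
    · exact hl
    · simp only [sub_zero, sub_self, max_eq_left hs]
      change (L : ℝ) * s ≤ a - a / 2
      linarith
  obtain ⟨α, hα⟩ := ODE.FunSpace.exists_isFixedPt_next hpl hx
  refine ⟨α.compProj, ?_, fun t ht => ⟨α.compProj_mem_closedBall hpl.mul_max_le, ?_⟩⟩
  · have := ODE.FunSpace.compProj_val (α := α) (t := ⟨0, Set.left_mem_Icc.2 hs⟩)
    rw [← ODE.FunSpace.next_apply₀ hpl hx α, hα, ← this]
  · apply ODE.hasDerivWithinAt_picard_Icc (Set.left_mem_Icc.2 hs) hpl.continuousOn_uncurry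
      α.continuous_compProj.continuousOn
      (fun _ ht' ↦ α.compProj_mem_closedBall hpl.mul_max_le) x ht |>.congr_of_mem _ ht
    intro t' ht'
    nth_rw 1 [← hα]
    exact (ODE.FunSpace.compProj_of_mem ht').trans (ODE.FunSpace.next_apply hpl hx α)

/-- Second order expansion of short integral curves. -/
lemma integralCurve_expansion {E : Type*} [NormedAddCommGroup E] [NormedSpace ℝ E]
    {X : E → E} {x₀ x a : E} {γ : ℝ → E} {s ε : ℝ} (D : E →L[ℝ] E) (hs : 0 ≤ s)
    (hγ0 : γ 0 = x)
    (hγ : ∀ t ∈ Icc 0 s, HasDerivWithinAt γ (X (γ t)) (Icc 0 s) t)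
    (hx : ‖x - x₀ - s • a‖ ≤ ε * s)
    (hD : ∀ t ∈ Icc 0 s, ‖X (γ t) - X x₀ - D (γ t - x₀)‖ ≤ ε * s)
    (hX : ∀ t ∈ Icc 0 s, ‖X (γ t) - X x₀‖ ≤ ε) :
    ‖γ s - x - s • X x₀ - s ^ 2 • (D a + (1 / 2 : ℝ) • D (X x₀))‖
      ≤ (ε + 2 * ‖D‖ * ε) * s ^ 2 := by
  have hε : 0 ≤ ε := le_trans (norm_nonneg _) (hX 0 ⟨le_refl _, hs⟩)
  have h1 : ∀ t ∈ Icc 0 s, ‖γ t - x - t • X x₀‖ ≤ ε * s := by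
    intro t ht
    have := (convex_Icc 0 s).norm_image_sub_le_of_norm_hasDerivWithin_le
      (f := fun t => γ t - t • X x₀) (f' := fun t => X (γ t) - X x₀) (C := ε) (x := 0) (y := t)
      (fun t ht => by
        have := (hγ t ht).sub ((hasDerivWithinAt_id t (Icc 0 s)).smul_const (X x₀))
        simpa using! this) hX ⟨le_refl _, hs⟩ ht
    have e : γ t - t • X x₀ - (γ 0 - (0:ℝ) • X x₀) = γ t - x - t • X x₀ := by
      rw [hγ0]; simp; abel
    rw [e] at this
    refine this.trans ?_
    gcongr
    rw [sub_zero, Real.norm_of_nonneg ht.1]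
    exact ht.2
  have h2 : ∀ t ∈ Icc 0 s, ‖X (γ t) - X x₀ - s • D a - t • D (X x₀)‖
      ≤ (ε + 2 * ‖D‖ * ε) * s := by
    intro t ht
    have e : X (γ t) - X x₀ - s • D a - t • D (X x₀) = (X (γ t) - X x₀ - D (γ t - x₀))
        + D (γ t - x - t • X x₀) + D (x - x₀ - s • a) := by
      simp only [map_sub, map_smul]; abel
    rw [e]
    have b1 := D.le_of_opNorm_le_of_le le_rfl (h1 t ht)
    have b2 := D.le_of_opNorm_le_of_le le_rfl hx
    have := norm_add₃_le (a := X (γ t) - X x₀ - D (γ t - x₀)) (b := D (γ t - x - t • X x₀))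
      (c := D (x - x₀ - s • a))
    have := hD t ht
    linarith
  have := (convex_Icc 0 s).norm_image_sub_le_of_norm_hasDerivWithin_le
      (f := fun t => γ t - t • X x₀ - t • s • D a - t ^ 2 • ((1 / 2 : ℝ) • D (X x₀)))
      (f' := fun t => X (γ t) - X x₀ - s • D a - t • D (X x₀))
      (C := (ε + 2 * ‖D‖ * ε) * s) (x := 0) (y := s)
      (fun t ht => by
        have h := (((hγ t ht).sub ((hasDerivWithinAt_id t (Icc 0 s)).smul_const (X x₀))).sub
          ((hasDerivWithinAt_id t (Icc 0 s)).smul_const (s • D a))).sub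
          (((hasDerivWithinAt_id t (Icc 0 s)).pow 2).smul_const ((1 / 2 : ℝ) • D (X x₀)))
        refine h.congr_deriv ?_
        simp [smul_smul]
        ring_nf) h2 ⟨le_refl _, hs⟩ ⟨hs, le_refl _⟩
  have e : γ s - s • X x₀ - s • s • D a - s ^ 2 • ((1 / 2 : ℝ) • D (X x₀)) - (γ 0 - (0:ℝ) • X x₀
      - (0:ℝ) • s • D a - (0:ℝ) ^ 2 • ((1 / 2 : ℝ) • D (X x₀)))
      = γ s - x - s • X x₀ - s ^ 2 • (D a + (1 / 2 : ℝ) • D (X x₀)) := by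
    rw [hγ0, smul_add, smul_smul s s, ← pow_two]; simp; abel
  rw [e] at this
  refine this.trans (le_of_eq ?_)
  rw [sub_zero, Real.norm_of_nonneg hs]; ring

lemma norm_sq_le_dotProduct {m : ℕ} (a : Fin m → ℝ) : ‖a‖ ^ 2 ≤ a ⬝ᵥ a := by
  have h0 : 0 ≤ a ⬝ᵥ a := Finset.sum_nonneg fun i _ => mul_self_nonneg _
  have : ‖a‖ ≤ Real.sqrt (a ⬝ᵥ a) := by
    refine (pi_norm_le_iff_of_nonneg (Real.sqrt_nonneg _)).2 fun i => Real.abs_le_sqrt ?_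
    rw [pow_two]
    exact Finset.single_le_sum (f := fun i => a i * a i) (fun i _ => mul_self_nonneg _)
      (Finset.mem_univ i)
  exact (Real.le_sqrt (norm_nonneg _) h0).1 this

lemma abs_dotProduct_le {m : ℕ} (a b : Fin m → ℝ) : |a ⬝ᵥ b| ≤ m * ‖a‖ * ‖b‖ := by
  refine (Finset.abs_sum_le_sum_abs _ _).trans ?_
  have : ∀ i ∈ (Finset.univ : Finset (Fin m)), |a i * b i| ≤ ‖a‖ * ‖b‖ := fun i _ => by
    rw [abs_mul]
    exact mul_le_mul (norm_le_pi_norm a i) (norm_le_pi_norm b i) (abs_nonneg _) (norm_nonneg _)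
  refine (Finset.sum_le_card_nsmul _ _ _ this).trans (le_of_eq ?_)
  simp [mul_assoc]

lemma dist_toLp_sq {m : ℕ} (x y : Fin m → ℝ) :
    dist (WithLp.toLp 2 x) (WithLp.toLp 2 y) ^ 2 = (x - y) ⬝ᵥ (x - y) := by
  rw [EuclideanSpace.dist_eq, Real.sq_sqrt (by positivity)]
  simp [dotProduct, Real.dist_eq, ← pow_two]

/-- `X` is orthogonal to all exterior normals of `Z` at points of `U`. -/
def TangentTo {m : ℕ} (Z U : Set (Fin m → ℝ)) (X : (Fin m → ℝ) → (Fin m → ℝ)) : Prop :=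
  ∀ z ∈ U, z ∈ Z → ∀ c : Fin m → ℝ,
    (∀ᶠ y in 𝓝 z, y ∈ Z → (z - c) ⬝ᵥ (z - c) ≤ (y - c) ⬝ᵥ (y - c)) → X z ⬝ᵥ (z - c) = 0

/-- A closed set is invariant under the flow of the fields tangent to it. -/
lemma TangentTo.integralCurve_mem {m : ℕ} {Z U : Set (Fin m → ℝ)}
    {X : (Fin m → ℝ) → (Fin m → ℝ)} (hT : TangentTo Z U X) {x₀ : Fin m → ℝ} {R ρ s : ℝ} {K : ℝ≥0}
    (hR : closedBall x₀ R ⊆ U) (hZ : IsClosed (Z ∩ closedBall x₀ R))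
    (hl : LipschitzOnWith K X (closedBall x₀ R)) (hs : 0 ≤ s) {γ : ℝ → Fin m → ℝ}
    (h0 : γ 0 ∈ Z) (hρ : ∀ t ∈ Icc 0 s, γ t ∈ closedBall x₀ ρ) (hρR : (2 * m + 3) * ρ < R)
    (hγ : ∀ t ∈ Icc 0 s, HasDerivWithinAt γ (X (γ t)) (Icc 0 s) t) : γ s ∈ Z := by
  have h0s : (0 : ℝ) ∈ Set.Icc 0 s := Set.left_mem_Icc.2 hs
  have hρ0 : 0 ≤ ρ := nonneg_of_mem_closedBall (hρ 0 h0s)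
  have hρR' : ρ < R := by nlinarith [Nat.cast_nonneg (α := ℝ) m, mul_nonneg (Nat.cast_nonneg (α := ℝ) m) hρ0]
  have hsub : closedBall x₀ ρ ⊆ closedBall x₀ R := closedBall_subset_closedBall hρR'.le
  set Q : Set (Fin m → ℝ) := Z ∩ closedBall x₀ R with hQ
  have hQc : IsCompact Q := (isCompact_closedBall x₀ R).of_isClosed_subset hZ Set.inter_subset_right
  set Q' : Set (EuclideanSpace ℝ (Fin m)) := WithLp.toLp 2 '' Q with hQ'
  have hQ'c : IsCompact Q' := hQc.image (PiLp.continuous_toLp 2 _)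
  have hγ0Q : γ 0 ∈ Q := ⟨h0, hsub (hρ 0 h0s)⟩
  have hQ'n : Q'.Nonempty := ⟨_, Set.mem_image_of_mem _ hγ0Q⟩
  set f : ℝ → ℝ := fun t => infDist (WithLp.toLp 2 (γ t)) Q' ^ 2 with hf
  have hfle : ∀ t, ∀ z ∈ Q, f t ≤ (γ t - z) ⬝ᵥ (γ t - z) := by
    intro t z hz
    rw [← dist_toLp_sq]
    exact pow_le_pow_left₀ infDist_nonneg (infDist_le_dist_of_mem (Set.mem_image_of_mem _ hz)) 2
  have hnear : ∀ t, ∃ z ∈ Q, f t = (γ t - z) ⬝ᵥ (γ t - z) := by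
    intro t
    obtain ⟨z', ⟨z, hz, rfl⟩, h⟩ := hQ'c.exists_infDist_eq_dist hQ'n (WithLp.toLp 2 (γ t))
    exact ⟨z, hz, by rw [← dist_toLp_sq, ← h]⟩
  have hγc : ContinuousOn γ (Set.Icc 0 s) := fun t ht => (hγ t ht).continuousWithinAt
  have hfc : ContinuousOn f (Set.Icc 0 s) :=
    ((continuous_infDist_pt Q').comp (PiLp.continuous_toLp 2 _)).comp_continuousOn hγc |>.pow 2
  have key : ∀ t ∈ Set.Ico 0 s, ∃ d : ℝ, d ≤ 2 * m * K * f t ∧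
      ∀ r, d < r → ∃ᶠ z in 𝓝[>] t, (z - t)⁻¹ * (f z - f t) < r := by
    intro t ht
    have htI : t ∈ Set.Icc 0 s := Set.Ico_subset_Icc_self ht
    obtain ⟨z, hz, hfz⟩ := hnear t
    have hzball : ‖z - x₀‖ < R := by
      have h1 : ‖γ t - z‖ ^ 2 ≤ (2 * (m + 1) * ρ) ^ 2 := by
        have ha := norm_sq_le_dotProduct (γ t - z)
        have hb := hfle t _ hγ0Q
        have hc := (le_abs_self _).trans (abs_dotProduct_le (γ t - γ 0) (γ t - γ 0))
        have hd : ‖γ t - γ 0‖ ≤ 2 * ρ := by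
          rw [← dist_eq_norm]
          have := dist_triangle_right (γ t) (γ 0) x₀
          have h1 := mem_closedBall.1 (hρ t htI)
          have h2 := mem_closedBall.1 (hρ 0 h0s)
          linarith
        have he : (m : ℝ) * ‖γ t - γ 0‖ * ‖γ t - γ 0‖ ≤ m * (2 * ρ) * (2 * ρ) := by gcongr
        have hm0 : (0 : ℝ) ≤ m := Nat.cast_nonneg m
        nlinarith [mul_nonneg hm0 (sq_nonneg ρ), mul_nonneg (sq_nonneg (m : ℝ)) (sq_nonneg ρ), sq_nonneg ρ]
      have h2 : ‖γ t - z‖ ≤ 2 * (m + 1) * ρ := (sq_le_sq₀ (norm_nonneg _) (by positivity)).1 h1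
      have h3 := mem_closedBall.1 (hρ t htI)
      rw [dist_eq_norm] at h3
      have : ‖z - x₀‖ ≤ ‖γ t - z‖ + ‖γ t - x₀‖ := by
        rw [norm_sub_rev (γ t) z]; exact norm_sub_le_norm_sub_add_norm_sub _ _ _
      nlinarith
    have hnormal : X z ⬝ᵥ (z - γ t) = 0 := by
      refine hT z (hR hz.2) hz.1 (γ t) ?_
      have : ∀ᶠ y in 𝓝 z, y ∈ closedBall x₀ R := by
        apply closedBall_mem_nhds_of_mem
        rw [mem_ball, dist_eq_norm]; exact hzball
      filter_upwards [this] with y hy hyZ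
      have := hfle t y ⟨hyZ, hy⟩
      rw [hfz, ← neg_sub z, ← neg_sub y, neg_dotProduct_neg, neg_dotProduct_neg] at this
      exact this
    have hder : HasDerivWithinAt (fun t' => (γ t' - z) ⬝ᵥ (γ t' - z))
        (2 * (X (γ t) ⬝ᵥ (γ t - z))) (Set.Icc 0 s) t := by
      have h := fun i => (hasDerivWithinAt_pi.1 (hγ t htI) i).sub_const (z i)
      have := HasDerivWithinAt.fun_sum (u := Finset.univ) (fun i _ => (h i).mul (h i))
      refine (this.congr_deriv ?_).congr_of_mem ?_ htI
      · simp only [dotProduct, Finset.mul_sum, Pi.sub_apply]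
        exact Finset.sum_congr rfl fun i _ => by ring
      · intro t' _
        simp [dotProduct]
    refine ⟨2 * (X (γ t) ⬝ᵥ (γ t - z)), ?_, ?_⟩
    · have e : X (γ t) ⬝ᵥ (γ t - z) = (X (γ t) - X z) ⬝ᵥ (γ t - z) := by
        rw [sub_dotProduct]
        rw [← neg_sub, dotProduct_neg, neg_eq_zero] at hnormal
        rw [hnormal, sub_zero]
      rw [e, hfz]
      have h1 := (le_abs_self _).trans (abs_dotProduct_le (X (γ t) - X z) (γ t - z))
      have h2 := hl.norm_sub_le (hsub (hρ t htI)) hz.2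
      have h3 : (m : ℝ) * ‖X (γ t) - X z‖ * ‖γ t - z‖ ≤ m * (K * ‖γ t - z‖) * ‖γ t - z‖ := by
        gcongr
      have h4 : (m : ℝ) * K * ‖γ t - z‖ ^ 2 ≤ m * K * ((γ t - z) ⬝ᵥ (γ t - z)) := by
        gcongr; exact norm_sq_le_dotProduct _
      nlinarith
    · intro r hr
      have hder' : HasDerivWithinAt (fun t' => (γ t' - z) ⬝ᵥ (γ t' - z))
        (2 * (X (γ t) ⬝ᵥ (γ t - z))) (Set.Ioi t) t :=
        (hder.mono (Set.Icc_subset_Icc_left htI.1)).mono_of_mem_nhdsWithin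
          (Icc_mem_nhdsGT ht.2)
      have hsl := hasDerivWithinAt_iff_tendsto_slope.1 hder'
      rw [Set.sdiff_singleton_eq_self (by simp)] at hsl
      refine Eventually.frequently ?_
      filter_upwards [hsl.eventually (gt_mem_nhds hr), self_mem_nhdsWithin] with t' h1 h2
      refine lt_of_le_of_lt ?_ h1
      rw [slope_def_field, div_eq_inv_mul, hfz]
      have : 0 < t' - t := sub_pos.2 h2
      gcongr
      exact hfle t' z hz
  choose! d hd1 hd2 using key
  have hfin := le_gronwallBound_of_liminf_deriv_right_le (δ := 0) (K := 2 * m * K) (ε := 0) hfc hd2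
    (by
      have := hfle 0 _ hγ0Q
      simpa using this) (by intro x hx; simpa using hd1 x hx) s (Set.right_mem_Icc.2 hs)
  have : f s ≤ 0 := by simpa [gronwallBound] using hfin
  obtain ⟨z, hz, hfz⟩ := hnear s
  have h1 := norm_sq_le_dotProduct (γ s - z)
  have h2 : ‖γ s - z‖ = 0 := by
    have : ‖γ s - z‖ ^ 2 ≤ 0 := by linarith
    exact pow_eq_zero_iff two_ne_zero |>.1 (le_antisymm this (sq_nonneg _))
  rw [sub_eq_zero.1 (norm_eq_zero.1 h2)]
  exact hz.1

/-- Following a tangent field for time `s` from a curve of points `p s` of `Z`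
produces another curve of points of `Z`, with controlled second order expansion. -/
lemma TangentTo.exists_flow_expansion {m : ℕ} {Z U : Set (Fin m → ℝ)}
    {X : (Fin m → ℝ) → (Fin m → ℝ)} (hT : TangentTo Z U X) (hU : IsOpen U) {x₀ : Fin m → ℝ}
    (hx₀ : x₀ ∈ U) (hX : ContDiffAt ℝ 1 X x₀) (hZ : ∃ R > 0, IsClosed (Z ∩ closedBall x₀ R))
    {p : ℝ → Fin m → ℝ} {a b : Fin m → ℝ} (hpZ : ∀ᶠ s in 𝓝[>] 0, p s ∈ Z)
    (hp : (fun s => p s - x₀ - s • a - s ^ 2 • b) =o[𝓝[>] 0] fun s => s ^ 2) :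
    ∃ p' : ℝ → Fin m → ℝ, (∀ᶠ s in 𝓝[>] 0, p' s ∈ Z) ∧
      (fun s => p' s - x₀ - s • (a + X x₀) - s ^ 2 • (b + (fderiv ℝ X x₀ a
        + (1 / 2 : ℝ) • fderiv ℝ X x₀ (X x₀)))) =o[𝓝[>] 0] fun s => s ^ 2 := by
  set D := fderiv ℝ X x₀ with hD
  obtain ⟨K, N, hN, hl⟩ := hX.exists_lipschitzOnWith
  obtain ⟨R₁, hR₁, hcl⟩ := hZ
  obtain ⟨R₂, hR₂, hsub⟩ := nhds_basis_closedBall.mem_iff.1 (Filter.inter_mem hN (hU.mem_nhds hx₀))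
  set R := min R₁ R₂ with hRdef
  have hR : 0 < R := lt_min hR₁ hR₂
  have hRN : closedBall x₀ R ⊆ N := fun y hy =>
    (hsub (closedBall_subset_closedBall (min_le_right _ _) hy)).1
  have hRU : closedBall x₀ R ⊆ U := fun y hy =>
    (hsub (closedBall_subset_closedBall (min_le_right _ _) hy)).2
  have hRcl : IsClosed (Z ∩ closedBall x₀ R) := by
    have := hcl.inter (isClosed_closedBall (x := x₀) (ε := R))
    rwa [Set.inter_assoc, Set.inter_eq_right.2
      (closedBall_subset_closedBall (min_le_left R₁ R₂))] at this
  replace hl := hl.mono hRN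
  set L : ℝ≥0 := K * R.toNNReal + ‖X x₀‖₊ with hL
  have hb : ∀ y ∈ closedBall x₀ R, ‖X y‖ ≤ L := by
    intro y hy
    have h1 := hl.norm_sub_le hy (mem_closedBall_self hR.le)
    have h2 : (K : ℝ) * ‖y - x₀‖ ≤ K * R := by
      gcongr; rw [← dist_eq_norm]; exact hy
    have h3 : ‖X y‖ ≤ ‖X y - X x₀‖ + ‖X x₀‖ := norm_le_norm_sub_add _ _
    have : (L : ℝ) = K * R + ‖X x₀‖ := by simp [hL, hR.le]
    linarith
  set ρ := R / (2 * (2 * m + 3)) with hρdef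
  have hρ : 0 < ρ := by positivity
  have hρR : (2 * m + 3) * ρ < R := by
    rw [hρdef]; field_simp; norm_num
  have hρR' : ρ ≤ R := by nlinarith [mul_nonneg (Nat.cast_nonneg (α := ℝ) m) hρ.le]
  have hballs : closedBall x₀ ρ ⊆ closedBall x₀ R := closedBall_subset_closedBall hρR'
  have hpos : ∀ᶠ s : ℝ in 𝓝[>] 0, 0 < s := self_mem_nhdsWithin
  have hsmall : ∀ δ > 0, ∀ᶠ s : ℝ in 𝓝[>] 0, s < δ := fun δ hδ =>
    mem_nhdsWithin_of_mem_nhds (gt_mem_nhds hδ)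
  -- first order control on `p`
  have hp1 : ∀ ε > 0, ∀ᶠ s : ℝ in 𝓝[>] 0, ‖p s - x₀ - s • a‖ ≤ ε * s := by
    intro ε hε
    filter_upwards [isLittleO_iff.1 hp one_pos, hpos, hsmall (ε / (1 + ‖b‖)) (by positivity)]
      with s h1 h2 h3
    have h4 : ‖p s - x₀ - s • a‖ ≤ ‖p s - x₀ - s • a - s ^ 2 • b‖ + ‖s ^ 2 • b‖ :=
      norm_le_norm_sub_add _ _
    rw [norm_smul] at h4
    rw [lt_div_iff₀ (by positivity)] at h3
    rw [Real.norm_of_nonneg (by positivity)] at h1 h4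
    nlinarith
  have hp2 : ∀ᶠ s : ℝ in 𝓝[>] 0, ‖p s - x₀‖ ≤ (1 + ‖a‖) * s := by
    filter_upwards [hp1 1 one_pos, hpos] with s h1 h2
    have h4 : ‖p s - x₀‖ ≤ ‖p s - x₀ - s • a‖ + ‖s • a‖ := norm_le_norm_sub_add _ _
    rw [norm_smul, Real.norm_of_nonneg h2.le] at h4
    linarith
  have hG : ∀ s : ℝ, ∃ γ : ℝ → Fin m → ℝ,
      (0 < s ∧ p s ∈ closedBall x₀ (ρ / 2) ∧ L * s ≤ ρ / 2) → γ 0 = p s ∧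
        ∀ t ∈ Set.Icc 0 s, γ t ∈ closedBall x₀ ρ ∧
          HasDerivWithinAt γ (X (γ t)) (Set.Icc 0 s) t := by
    intro s
    by_cases h : 0 < s ∧ p s ∈ closedBall x₀ (ρ / 2) ∧ L * s ≤ ρ / 2
    · obtain ⟨γ, hγ⟩ := exists_integralCurve_in_closedBall (fun y hy => hb y (hballs hy))
        (hl.mono hballs) h.2.1 h.1.le h.2.2
      exact ⟨γ, fun _ => hγ⟩
    · exact ⟨0, fun h' => absurd h' h⟩
  choose G hG using hG
  have hgood : ∀ᶠ s : ℝ in 𝓝[>] 0, 0 < s ∧ p s ∈ closedBall x₀ (ρ / 2) ∧ L * s ≤ ρ / 2 := by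
    filter_upwards [hp2, hpos, hsmall (ρ / 2 / (1 + ‖a‖)) (by positivity),
      hsmall (ρ / 2 / (L + 1)) (by positivity)] with s h1 h2 h3 h4
    rw [lt_div_iff₀ (by positivity)] at h3 h4
    refine ⟨h2, ?_, ?_⟩
    · rw [mem_closedBall, dist_eq_norm]; linarith
    · linarith
  refine ⟨fun s => G s s, ?_, ?_⟩
  · filter_upwards [hgood, hpZ] with s hs hsZ
    obtain ⟨h0, h1⟩ := hG s hs
    exact hT.integralCurve_mem hRU hRcl hl hs.1.le (h0 ▸ hsZ) (fun t ht => (h1 t ht).1) hρR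
      (fun t ht => (h1 t ht).2)
  · refine isLittleO_iff.2 fun c hc => ?_
    set ε := c / (2 + 2 * ‖D‖) with hε
    have hε0 : 0 < ε := by positivity
    have hcε : c = (2 + 2 * ‖D‖) * ε := by rw [hε]; field_simp
    set M : ℝ := 1 + ‖a‖ + L with hM
    have hM0 : 0 < M := by positivity
    have hDx : ∀ᶠ y in 𝓝 x₀, ‖X y - X x₀ - D (y - x₀)‖ ≤ ε / M * ‖y - x₀‖ :=
      isLittleO_iff.1 (hX.differentiableAt one_ne_zero).hasFDerivAt.isLittleO (by positivity)
    have hXx : ∀ᶠ y in 𝓝 x₀, ‖X y - X x₀‖ ≤ ε := by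
      filter_upwards [hX.continuousAt.eventually (closedBall_mem_nhds _ hε0)] with y hy
      rwa [← dist_eq_norm]
    obtain ⟨δ, hδ, hδs⟩ := nhds_basis_closedBall.mem_iff.1 (hDx.and hXx)
    filter_upwards [hgood, hp1 ε hε0, hp2, hsmall (δ / M) (by positivity), isLittleO_iff.1 hp hε0]
      with s hs h1 h2 h3 h4
    obtain ⟨h0, hγ⟩ := hG s hs
    rw [lt_div_iff₀ hM0] at h3
    have hbd : ∀ t ∈ Set.Icc 0 s, ‖G s t - x₀‖ ≤ M * s := by
      intro t ht
      have := (convex_Icc 0 s).norm_image_sub_le_of_norm_hasDerivWithin_le (C := L)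
        (fun t ht => (hγ t ht).2) (fun t ht => hb _ (hballs (hγ t ht).1))
        (Set.left_mem_Icc.2 hs.1.le) ht
      rw [h0, sub_zero, Real.norm_of_nonneg ht.1] at this
      have h5 : ‖G s t - x₀‖ ≤ ‖G s t - p s‖ + ‖p s - x₀‖ := norm_sub_le_norm_sub_add_norm_sub _ _ _
      have h6 : (L : ℝ) * t ≤ L * s := by gcongr; exact ht.2
      rw [hM]; linarith
    have hin : ∀ t ∈ Set.Icc 0 s, G s t ∈ closedBall x₀ δ := fun t ht => by
      rw [mem_closedBall, dist_eq_norm]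
      exact (hbd t ht).trans (by linarith)
    have hexp := integralCurve_expansion D hs.1.le h0 (fun t ht => (hγ t ht).2) h1
      (fun t ht => by
        refine ((hδs (hin t ht)).1).trans ?_
        calc ε / M * ‖G s t - x₀‖ ≤ ε / M * (M * s) := by gcongr; exact hbd t ht
          _ = ε * s := by field_simp)
      (fun t ht => (hδs (hin t ht)).2)
    rw [Real.norm_of_nonneg (by positivity)] at h4 ⊢
    have e : G s s - x₀ - s • (a + X x₀) - s ^ 2 • (b + (D a + (1 / 2 : ℝ) • D (X x₀)))
        = (G s s - p s - s • X x₀ - s ^ 2 • (D a + (1 / 2 : ℝ) • D (X x₀)))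
          + (p s - x₀ - s • a - s ^ 2 • b) := by
      simp only [smul_add]; abel
    rw [e]
    refine (norm_add_le _ _).trans ((add_le_add hexp h4).trans (le_of_eq ?_))
    rw [hcε]; ring

lemma TangentTo.neg {m : ℕ} {Z U : Set (Fin m → ℝ)} {X : (Fin m → ℝ) → (Fin m → ℝ)}
    (hT : TangentTo Z U X) : TangentTo Z U (fun x => -X x) := fun z hzU hz c hc => by
  rw [neg_dotProduct, hT z hzU hz c hc, neg_zero]

lemma TangentTo.add {m : ℕ} {Z U : Set (Fin m → ℝ)} {X Y : (Fin m → ℝ) → (Fin m → ℝ)}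
    (hX : TangentTo Z U X) (hY : TangentTo Z U Y) : TangentTo Z U (fun x => X x + Y x) :=
  fun z hzU hz c hc => by
    rw [add_dotProduct, hX z hzU hz c hc, hY z hzU hz c hc, add_zero]

lemma TangentTo.smul {m : ℕ} {Z U : Set (Fin m → ℝ)} {X : (Fin m → ℝ) → (Fin m → ℝ)}
    (hX : TangentTo Z U X) (f : (Fin m → ℝ) → ℝ) : TangentTo Z U (fun x => f x • X x) :=
  fun z hzU hz c hc => by
    rw [smul_dotProduct, hX z hzU hz c hc, smul_zero]

lemma TangentTo.lieBr_dotProduct_nonneg {m : ℕ} {Z U : Set (Fin m → ℝ)}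
    {X Y : (Fin m → ℝ) → (Fin m → ℝ)} (hX : TangentTo Z U X) (hY : TangentTo Z U Y)
    (hU : IsOpen U) {z : Fin m → ℝ} (hzU : z ∈ U) (hz : z ∈ Z) (hXd : ContDiffAt ℝ 1 X z)
    (hYd : ContDiffAt ℝ 1 Y z) (hZ : ∃ R > 0, IsClosed (Z ∩ closedBall z R)) {c : Fin m → ℝ}
    (hc : ∀ᶠ y in 𝓝 z, y ∈ Z → (z - c) ⬝ᵥ (z - c) ≤ (y - c) ⬝ᵥ (y - c)) :
    0 ≤ lieBr X Y z ⬝ᵥ (z - c) := by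
  obtain ⟨p1, h1Z, h1⟩ := hX.exists_flow_expansion hU hzU hXd hZ (p := fun _ => z) (a := 0) (b := 0)
    (Eventually.of_forall fun _ => hz) (by simp)
  obtain ⟨p2, h2Z, h2⟩ := hY.exists_flow_expansion hU hzU hYd hZ h1Z h1
  obtain ⟨p3, h3Z, h3⟩ := hX.neg.exists_flow_expansion hU hzU hXd.neg hZ h2Z h2
  obtain ⟨p, hpZ, hp⟩ := hY.neg.exists_flow_expansion hU hzU hYd.neg hZ h3Z h3
  have hfX : fderiv ℝ (fun x => -X x) z = -fderiv ℝ X z := fderiv_fun_neg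
  have hfY : fderiv ℝ (fun x => -Y x) z = -fderiv ℝ Y z := fderiv_fun_neg
  have hp' : (fun s => p s - z - s ^ 2 • lieBr X Y z) =o[𝓝[>] 0] fun s : ℝ => s ^ 2 := by
    refine hp.congr_left fun s => ?_
    rw [hfX, hfY, lieBr]
    simp only [neg_apply, map_add, map_neg, map_zero]
    module
  have hlim : Tendsto (fun s : ℝ => (s ^ 2)⁻¹ • (p s - z)) (𝓝[>] 0) (𝓝 (lieBr X Y z)) := by
    have := (hp'.tendsto_inv_smul_nhds_zero).add_const (lieBr X Y z)
    rw [zero_add] at this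
    refine this.congr' ?_
    filter_upwards [self_mem_nhdsWithin] with s hs
    have : (s ^ 2) ≠ 0 := pow_ne_zero _ (ne_of_gt hs)
    rw [smul_sub _ (p s - z), smul_smul, inv_mul_cancel₀ this, one_smul, sub_add_cancel]
  have hs0 : Tendsto (fun s : ℝ => s ^ 2) (𝓝[>] 0) (𝓝 0) := by
    have : Tendsto (fun s : ℝ => s ^ 2) (𝓝 0) (𝓝 (0 ^ 2)) := (continuous_pow 2).tendsto 0
    rw [zero_pow two_ne_zero] at this
    exact this.mono_left nhdsWithin_le_nhds
  have hpz : Tendsto p (𝓝[>] 0) (𝓝 z) := by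
    have := (hs0.smul hlim).add_const z
    rw [zero_smul, zero_add] at this
    refine this.congr' ?_
    filter_upwards [self_mem_nhdsWithin] with s hs
    have : (s ^ 2) ≠ 0 := pow_ne_zero _ (ne_of_gt hs)
    rw [smul_smul, mul_inv_cancel₀ this, one_smul, sub_add_cancel]
  have hdot : ∀ {f g : ℝ → Fin m → ℝ} {a b : Fin m → ℝ}, Tendsto f (𝓝[>] 0) (𝓝 a) →
      Tendsto g (𝓝[>] 0) (𝓝 b) → Tendsto (fun s => f s ⬝ᵥ g s) (𝓝[>] 0) (𝓝 (a ⬝ᵥ b)) :=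
    fun hf hg => tendsto_finsetSum _ fun i _ =>
      (tendsto_pi_nhds.1 hf i).mul (tendsto_pi_nhds.1 hg i)
  have hfin := (((hdot hlim (tendsto_const_nhds (x := z - c))).const_mul 2).add
    (hs0.mul (hdot hlim hlim)))
  rw [zero_mul, add_zero] at hfin
  have := ge_of_tendsto hfin (b := 0) (by
    filter_upwards [self_mem_nhdsWithin, hpz.eventually hc, hpZ] with s hs h1 h2
    have h3 := h1 h2
    have hs2 : 0 < s ^ 2 := pow_pos hs 2
    have e : p s - c = (p s - z) + (z - c) := by abel
    rw [e, add_dotProduct, dotProduct_add, dotProduct_add, dotProduct_comm (z - c) (p s - z)] at h3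
    simp only [smul_dotProduct, dotProduct_smul, smul_eq_mul]
    have h4 : 0 ≤ (s ^ 2)⁻¹ * (2 * ((p s - z) ⬝ᵥ (z - c)) + (p s - z) ⬝ᵥ (p s - z)) := by
      apply mul_nonneg (by positivity); linarith
    refine h4.trans (le_of_eq ?_)
    field_simp)
  linarith

lemma TangentTo.lieBr {m : ℕ} {Z U : Set (Fin m → ℝ)} {X Y : (Fin m → ℝ) → (Fin m → ℝ)}
    (hX : TangentTo Z U X) (hY : TangentTo Z U Y) (hU : IsOpen U) (hXd : ContDiffOn ℝ 1 X U)
    (hYd : ContDiffOn ℝ 1 Y U) (hZ : ∀ z ∈ U, ∃ R > 0, IsClosed (Z ∩ closedBall z R)) :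
    TangentTo Z U (lieBr X Y) := by
  intro z hzU hz c hc
  have hXd := hXd.contDiffAt (hU.mem_nhds hzU)
  have hYd := hYd.contDiffAt (hU.mem_nhds hzU)
  have h1 := hX.lieBr_dotProduct_nonneg hY hU hzU hz hXd hYd (hZ z hzU) hc
  have h2 := hY.lieBr_dotProduct_nonneg hX hU hzU hz hYd hXd (hZ z hzU) hc
  have e : _root_.lieBr Y X z = -_root_.lieBr X Y z := by simp [_root_.lieBr]
  rw [e, neg_dotProduct] at h2
  linarith

lemma LieSpan.tangentTo {m : ℕ} {Z U : Set (Fin m → ℝ)} (hU : IsOpen U)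
    {S : Set ((Fin m → ℝ) → (Fin m → ℝ))} (hS : ∀ X ∈ S, ContDiffOn ℝ (⊤ : ℕ∞) X U)
    (hT : ∀ X ∈ S, TangentTo Z U X) (hZ : ∀ z ∈ U, ∃ R > 0, IsClosed (Z ∩ closedBall z R))
    {X : (Fin m → ℝ) → (Fin m → ℝ)} (hX : LieSpan U S X) :
    ContDiffOn ℝ (⊤ : ℕ∞) X U ∧ TangentTo Z U X := by
  induction hX with
  | base X hX => exact ⟨hS X hX, hT X hX⟩
  | smul f X hf _ ih => exact ⟨hf.smul ih.1, ih.2.smul f⟩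
  | add X Y _ _ ihX ihY => exact ⟨ihX.1.add ihY.1, ihX.2.add ihY.2⟩
  | bracket X Y _ _ ihX ihY =>
    refine ⟨?_, ihX.2.lieBr ihY.2 hU (ihX.1.of_le (by norm_cast)) (ihY.1.of_le (by norm_cast))
      hZ⟩
    exact ((ihY.1.fderiv_of_isOpen hU (by simp)).clm_apply ihX.1).sub
      ((ihX.1.fderiv_of_isOpen hU (by simp)).clm_apply ihY.1)

/-- If the Lie span of fields tangent to a relatively closed set `Z` has full rank, then `Z`
is open. -/
lemma mem_nhds_of_lieSpan_tangentTo {m : ℕ} {Z U : Set (Fin m → ℝ)} (hU : IsOpen U)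
    {S : Set ((Fin m → ℝ) → (Fin m → ℝ))} (hS : ∀ X ∈ S, ContDiffOn ℝ (⊤ : ℕ∞) X U)
    (hT : ∀ X ∈ S, TangentTo Z U X) (hZ : ∀ z ∈ U, ∃ R > 0, IsClosed (Z ∩ closedBall z R))
    (hspan : ∀ x ∈ U, Submodule.span ℝ {v | ∃ X, LieSpan U S X ∧ X x = v} = ⊤)
    {p : Fin m → ℝ} (hpU : p ∈ U) (hpZ : p ∈ Z) : Z ∈ 𝓝 p := by
  obtain ⟨R₁, hR₁, hcl₁⟩ := hZ p hpU
  obtain ⟨R₂, hR₂, hsub⟩ := nhds_basis_closedBall.mem_iff.1 (hU.mem_nhds hpU)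
  set R := min R₁ R₂ with hRdef
  have hR : 0 < R := lt_min hR₁ hR₂
  have hcl : IsClosed (Z ∩ closedBall p R) := by
    have := hcl₁.inter (isClosed_closedBall (x := p) (ε := R))
    rwa [Set.inter_assoc, Set.inter_eq_right.2
      (closedBall_subset_closedBall (min_le_left R₁ R₂))] at this
  have hcomp : IsCompact (Z ∩ closedBall p R) :=
    (isCompact_closedBall p R).of_isClosed_subset hcl Set.inter_subset_right
  set δ := R / (m + 2) with hδdef
  have hm0 : (0 : ℝ) ≤ m := Nat.cast_nonneg m
  have hδ : 0 < δ := by positivity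
  have hδR : (m + 1) * δ < R := by
    have : (m + 2) * δ = R := by rw [hδdef]; field_simp
    linarith
  refine Filter.mem_of_superset (ball_mem_nhds p hδ) fun y hy => ?_
  have hcont : ContinuousOn (fun z : Fin m → ℝ => (z - y) ⬝ᵥ (z - y)) (Z ∩ closedBall p R) := by
    unfold dotProduct; fun_prop
  obtain ⟨z, hz, hmin⟩ := hcomp.exists_isMinOn ⟨p, hpZ, mem_closedBall_self hR.le⟩ hcont
  have hzmin : ∀ z' ∈ Z ∩ closedBall p R, (z - y) ⬝ᵥ (z - y) ≤ (z' - y) ⬝ᵥ (z' - y) :=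
    fun z' hz' => hmin hz'
  have hyp : ‖p - y‖ < δ := by rw [← dist_eq_norm, dist_comm]; exact hy
  have hzy : ‖z - y‖ ≤ m * δ := by
    have h1 := norm_sq_le_dotProduct (z - y)
    have h2 := hzmin p ⟨hpZ, mem_closedBall_self hR.le⟩
    have h3 := (le_abs_self _).trans (abs_dotProduct_le (p - y) (p - y))
    have h4 : (m : ℝ) * ‖p - y‖ * ‖p - y‖ ≤ m * δ * δ := by gcongr
    have h5 : (m : ℝ) * δ * δ ≤ (m * δ) ^ 2 := by
      rcases Nat.eq_zero_or_pos m with h | h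
      · simp [h]
      · have : (1 : ℝ) ≤ m := by exact_mod_cast h
        nlinarith [mul_nonneg hm0 (sq_nonneg δ)]
    exact (sq_le_sq₀ (norm_nonneg _) (by positivity)).1 (by linarith)
  have hzint : z ∈ ball p R := by
    rw [mem_ball, dist_eq_norm]
    have : ‖z - p‖ ≤ ‖z - y‖ + ‖y - p‖ := norm_sub_le_norm_sub_add_norm_sub _ _ _
    rw [norm_sub_rev y p] at this
    linarith
  have hzU : z ∈ U := hsub (closedBall_subset_closedBall (min_le_right _ _) hz.2)
  have hnorm : ∀ᶠ z' in 𝓝 z, z' ∈ Z → (z - y) ⬝ᵥ (z - y) ≤ (z' - y) ⬝ᵥ (z' - y) := by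
    filter_upwards [isOpen_ball.mem_nhds hzint] with z' hz' hz'Z
    exact hzmin z' ⟨hz'Z, ball_subset_closedBall hz'⟩
  have hall : ∀ v ∈ Submodule.span ℝ {v | ∃ X, LieSpan U S X ∧ X z = v}, v ⬝ᵥ (z - y) = 0 := by
    intro v hv
    induction hv using Submodule.span_induction with
    | mem v hv =>
      obtain ⟨X, hX, rfl⟩ := hv
      exact (hX.tangentTo hU hS hT hZ).2 z hzU hz.1 y hnorm
    | zero => exact zero_dotProduct _
    | add a b _ _ ha hb => rw [add_dotProduct, ha, hb, add_zero]
    | smul r a _ ha => rw [smul_dotProduct, ha, smul_zero]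
  have := hall (z - y) (by rw [hspan z hzU]; trivial)
  rw [dotProduct_self_eq_zero, sub_eq_zero] at this
  exact this ▸ hz.1

lemma ee_eq_single {m : ℕ} (i : Fin m) : ee m i = Pi.single i 1 := by
  ext j; simp [ee, Pi.single_apply, Fin.ext_iff]

/-- The Euclidean normalization of a vector. -/
def euclNormalize {m : ℕ} (g : Fin m → ℝ) : Fin m → ℝ := fun i => g i / Real.sqrt (∑ k, g k ^ 2)

/-- The gradient in coordinates. -/
def coordGrad {m : ℕ} (w : (Fin m → ℝ) → ℝ) (x : Fin m → ℝ) : Fin m → ℝ :=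
  fun i => fderiv ℝ w x (Pi.single i 1)

lemma sum_sq_pos {m : ℕ} {g : Fin m → ℝ} (hg : g ≠ 0) : 0 < ∑ k, g k ^ 2 := by
  obtain ⟨i, hi⟩ := Function.ne_iff.1 hg
  exact Finset.sum_pos' (fun _ _ => sq_nonneg _) ⟨i, Finset.mem_univ _, by
    have : g i ≠ 0 := hi
    positivity⟩

lemma contDiffAt_euclNormalize {m : ℕ} {n : WithTop ℕ∞} {g : Fin m → ℝ} (hg : g ≠ 0) :
    ContDiffAt ℝ n euclNormalize g := by
  have h := sum_sq_pos hg
  rw [contDiffAt_pi]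
  intro i
  refine ContDiffAt.div (by fun_prop) (ContDiffAt.sqrt (by fun_prop) h.ne') (Real.sqrt_pos.2 h).ne'

lemma fderiv_euclNormalize {m : ℕ} {g : Fin m → ℝ} (hg : g ≠ 0) (h : Fin m → ℝ) (i : Fin m) :
    fderiv ℝ euclNormalize g h i = (h i - euclNormalize g i * (euclNormalize g ⬝ᵥ h))
      / Real.sqrt (∑ k, g k ^ 2) := by
  have h0 := sum_sq_pos hg
  set ρ := Real.sqrt (∑ k, g k ^ 2) with hρ
  have hρ0 : 0 < ρ := Real.sqrt_pos.2 h0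
  have hd : DifferentiableAt ℝ euclNormalize g :=
    (contDiffAt_euclNormalize hg (n := 1)).differentiableAt one_ne_zero
  have h1 : HasDerivAt (fun t : ℝ => euclNormalize (g + t • h) i) (fderiv ℝ euclNormalize g h i) 0 := by
    have h2 : HasDerivAt (fun t : ℝ => g + t • h) h 0 := by
      simpa using ((hasDerivAt_id (0:ℝ)).smul_const h).const_add g
    have h3 : HasFDerivAt euclNormalize (fderiv ℝ euclNormalize g) (g + (0:ℝ) • h) := by
      simpa using hd.hasFDerivAt
    exact (hasDerivAt_pi.1 (h3.comp_hasDerivAt (0:ℝ) h2)) i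
  have hl : ∀ k, HasDerivAt (fun t : ℝ => g k + t * h k) (h k) 0 := fun k => by
    simpa using ((hasDerivAt_id (0:ℝ)).mul_const (h k)).const_add (g k)
  have hs : HasDerivAt (fun t : ℝ => ∑ k, (g k + t * h k) ^ 2) (∑ k, 2 * g k * h k) 0 := by
    have := HasDerivAt.fun_sum (u := Finset.univ) (fun k _ => (hl k).pow 2)
    simpa using this
  have hq : HasDerivAt (fun t : ℝ => Real.sqrt (∑ k, (g k + t * h k) ^ 2))
      ((∑ k, 2 * g k * h k) / (2 * ρ)) 0 := by
    have := hs.sqrt (by simpa using h0.ne')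
    simpa [hρ] using this
  have h4 := (hl i).fun_div hq (by simpa [← hρ] using hρ0.ne')
  have h5 := h1.unique (by simpa [euclNormalize] using h4)
  rw [h5]
  have h6 : ∑ k, 2 * g k * h k = 2 * ρ * (euclNormalize g ⬝ᵥ h) := by
    simp only [euclNormalize, dotProduct, Finset.mul_sum, ← hρ]
    refine Finset.sum_congr rfl fun k _ => ?_
    field_simp
  rw [h6]
  simp only [← hρ, euclNormalize]
  field_simp

lemma contDiffAt_coordGrad {m : ℕ} {u : (Fin m → ℝ) → ℝ} {x : Fin m → ℝ}
    (hu : ContDiffAt ℝ 2 u x) : ContDiffAt ℝ 1 (coordGrad u) x := by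
  have := hu.fderiv_right (m := 1) (by norm_num)
  rw [contDiffAt_pi]
  intro i
  exact this.clm_apply contDiffAt_const

lemma gradF_eq {m : ℕ} (F : (Fin m → ℝ) → (Fin m → ℝ)) (u : (Fin m → ℝ) → ℝ) :
    gradF m F u = fun x => coordGrad u x + F x := by
  ext x i
  simp [gradF, pd, coordGrad, ee_eq_single]

lemma contDiffAt_gradF {m : ℕ} {F : (Fin m → ℝ) → (Fin m → ℝ)} {u : (Fin m → ℝ) → ℝ}
    {x : Fin m → ℝ} (hF : ContDiffAt ℝ 1 F x) (hu : ContDiffAt ℝ 2 u x) :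
    ContDiffAt ℝ 1 (gradF m F u) x := by
  rw [gradF_eq]
  exact (contDiffAt_coordGrad hu).add hF

lemma legN_eq {m : ℕ} (F : (Fin m → ℝ) → (Fin m → ℝ)) (u : (Fin m → ℝ) → ℝ) (x : Fin m → ℝ) :
    legN m F u x = euclNormalize (gradF m F u x) := rfl

lemma Hmc_eq {m : ℕ} {F : (Fin m → ℝ) → (Fin m → ℝ)} {u : (Fin m → ℝ) → ℝ}
    {x : Fin m → ℝ} (hF : ContDiffAt ℝ 1 F x) (hu : ContDiffAt ℝ 2 u x) (h0 : gradF m F u x ≠ 0) :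
    Hmc m F u x = ∑ i, fderiv ℝ euclNormalize (gradF m F u x)
      (fderiv ℝ (gradF m F u) x (Pi.single i 1)) i := by
  have hG := (contDiffAt_gradF hF hu).differentiableAt one_ne_zero
  have hN := (contDiffAt_euclNormalize h0 (n := 1)).differentiableAt one_ne_zero
  refine Finset.sum_congr rfl fun i _ => ?_
  have h := hN.hasFDerivAt.comp x hG.hasFDerivAt
  have hi := hasFDerivAt_pi'.1 h i
  have : (fun y => legN m F u y i) = fun y => (euclNormalize ∘ gradF m F u) y i := rfl
  rw [pd, this, hi.fderiv, ee_eq_single]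
  rfl

lemma euclNormalize_dotProduct_self {m : ℕ} {g : Fin m → ℝ} (hg : g ≠ 0) :
    euclNormalize g ⬝ᵥ euclNormalize g = 1 := by
  have h0 := sum_sq_pos hg
  have : euclNormalize g ⬝ᵥ euclNormalize g = (∑ k, g k ^ 2) / (Real.sqrt (∑ k, g k ^ 2)) ^ 2 := by
    simp only [euclNormalize, dotProduct, Finset.sum_div]
    refine Finset.sum_congr rfl fun k _ => ?_
    ring
  rw [this, Real.sq_sqrt h0.le, div_self h0.ne']

lemma IsLocalMin.deriv_deriv_nonneg {f : ℝ → ℝ} {a : ℝ} (h : IsLocalMin f a)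
    (hc : ContinuousAt f a) : 0 ≤ deriv (deriv f) a := by
  by_contra! hneg
  have hmax := isLocalMax_of_deriv_deriv_neg hneg h.deriv_eq_zero hc
  have hconst : f =ᶠ[𝓝 a] fun _ => f a := by
    filter_upwards [h, hmax] with x h1 h2 using le_antisymm h2 h1
  have : deriv (deriv f) a = 0 := by
    rw [hconst.deriv.deriv_eq]; simp
  linarith

lemma deriv_deriv_comp_line {m : ℕ} {f : (Fin m → ℝ) → ℝ} {x : Fin m → ℝ}
    (hf : ContDiffAt ℝ 2 f x) (b : Fin m → ℝ) :
    deriv (deriv fun t : ℝ => f (x + t • b)) 0 = fderiv ℝ (fderiv ℝ f) x b b := by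
  have hl : ∀ t : ℝ, HasDerivAt (fun t : ℝ => x + t • b) b t := fun t => by
    simpa using ((hasDerivAt_id t).smul_const b).const_add x
  have hc : Tendsto (fun t : ℝ => x + t • b) (𝓝 0) (𝓝 x) := by
    have := (hl 0).continuousAt.tendsto
    simpa using this
  have h1 : deriv (fun t : ℝ => f (x + t • b)) =ᶠ[𝓝 0] fun t => fderiv ℝ f (x + t • b) b := by
    filter_upwards [hc.eventually (hf.eventually (by simp))] with t ht
    exact ((ht.differentiableAt two_ne_zero).hasFDerivAt.comp_hasDerivAt t (hl t)).deriv
  rw [h1.deriv_eq]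
  have h2 : DifferentiableAt ℝ (fderiv ℝ f) x :=
    (hf.fderiv_right (m := 1) (by norm_num)).differentiableAt one_ne_zero
  have h3 : HasFDerivAt (fderiv ℝ f) (fderiv ℝ (fderiv ℝ f) x) (x + (0:ℝ) • b) := by
    simpa using h2.hasFDerivAt
  have h5 : HasDerivAt (fun t : ℝ => fderiv ℝ f (x + t • b)) (fderiv ℝ (fderiv ℝ f) x b) 0 :=
    h3.comp_hasDerivAt (0:ℝ) (hl 0)
  have h6 := h5.clm_apply (hasDerivAt_const (0:ℝ) b)
  rw [h6.deriv, map_zero, add_zero]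

lemma IsLocalMin.fderiv_fderiv_nonneg {m : ℕ} {f : (Fin m → ℝ) → ℝ} {x : Fin m → ℝ}
    (h : IsLocalMin f x) (hf : ContDiffAt ℝ 2 f x) (b : Fin m → ℝ) :
    0 ≤ fderiv ℝ (fderiv ℝ f) x b b := by
  rw [← deriv_deriv_comp_line hf]
  have hc : ContinuousAt (fun t : ℝ => x + t • b) 0 := by fun_prop
  have hc' : Tendsto (fun t : ℝ => x + t • b) (𝓝 0) (𝓝 x) := by simpa using hc.tendsto
  refine IsLocalMin.deriv_deriv_nonneg ?_ ?_
  · have := hc'.eventually h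
    simpa [IsLocalMin, IsMinFilter] using this
  · exact ContinuousAt.comp (g := f) (by simpa using hf.continuousAt) hc

/-- The Gaussian barrier `exp (-K |x - c|²)`. -/
def gaussBarrier {m : ℕ} (K : ℝ) (c x : Fin m → ℝ) : ℝ := Real.exp (-K * ((x - c) ⬝ᵥ (x - c)))

lemma contDiff_gaussBarrier {m : ℕ} {n : WithTop ℕ∞} (K : ℝ) (c : Fin m → ℝ) :
    ContDiff ℝ n (gaussBarrier K c) := by
  unfold gaussBarrier dotProduct
  simp only [Pi.sub_apply]
  fun_prop

lemma hasDerivAt_gaussBarrier_line {m : ℕ} (K : ℝ) (c x b : Fin m → ℝ) (t : ℝ) :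
    HasDerivAt (fun t : ℝ => gaussBarrier K c (x + t • b))
      (gaussBarrier K c (x + t • b) * (-K * (2 * ((x - c) ⬝ᵥ b) + 2 * t * (b ⬝ᵥ b)))) t := by
  have h1 : ∀ t : ℝ, (x + t • b - c) ⬝ᵥ (x + t • b - c)
      = (x - c) ⬝ᵥ (x - c) + 2 * t * ((x - c) ⬝ᵥ b) + t ^ 2 * (b ⬝ᵥ b) := by
    intro t
    have : x + t • b - c = (x - c) + t • b := by abel
    rw [this]
    simp only [add_dotProduct, dotProduct_add, smul_dotProduct, dotProduct_smul, smul_eq_mul,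
      dotProduct_comm b (x - c)]
    ring
  simp only [gaussBarrier, h1]
  refine HasDerivAt.exp ?_
  have h2 : HasDerivAt (fun t : ℝ => (x - c) ⬝ᵥ (x - c) + 2 * t * ((x - c) ⬝ᵥ b) + t ^ 2 * (b ⬝ᵥ b))
      (2 * ((x - c) ⬝ᵥ b) + 2 * t * (b ⬝ᵥ b)) t := by
    have := ((((hasDerivAt_id t).const_mul 2).mul_const ((x - c) ⬝ᵥ b)).const_add
      ((x - c) ⬝ᵥ (x - c))).fun_add (((hasDerivAt_id t).fun_pow 2).mul_const (b ⬝ᵥ b))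
    simpa using this
  exact h2.const_mul (-K)

lemma fderiv_gaussBarrier {m : ℕ} (K : ℝ) (c x b : Fin m → ℝ) :
    fderiv ℝ (gaussBarrier K c) x b = -(2 * K * gaussBarrier K c x * ((x - c) ⬝ᵥ b)) := by
  have hd : DifferentiableAt ℝ (gaussBarrier K c) x :=
    (contDiff_gaussBarrier K c (n := 1)).differentiable one_ne_zero x
  have h1 : HasFDerivAt (gaussBarrier K c) (fderiv ℝ (gaussBarrier K c) x) (x + (0:ℝ) • b) := by
    simpa using hd.hasFDerivAt
  have h2 : HasDerivAt (fun t : ℝ => x + t • b) b 0 := by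
    simpa using ((hasDerivAt_id (0:ℝ)).smul_const b).const_add x
  have h4 : HasDerivAt (fun t : ℝ => gaussBarrier K c (x + t • b))
      (fderiv ℝ (gaussBarrier K c) x b) 0 := by
    exact h1.comp_hasDerivAt (0:ℝ) h2
  rw [h4.unique (hasDerivAt_gaussBarrier_line K c x b 0)]
  simp only [zero_smul, add_zero, mul_zero, zero_mul]
  ring

lemma fderiv_fderiv_gaussBarrier {m : ℕ} (K : ℝ) (c x b : Fin m → ℝ) :
    fderiv ℝ (fderiv ℝ (gaussBarrier K c)) x b b
      = gaussBarrier K c x * (4 * K ^ 2 * ((x - c) ⬝ᵥ b) ^ 2 - 2 * K * (b ⬝ᵥ b)) := by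
  rw [← deriv_deriv_comp_line (contDiff_gaussBarrier K c).contDiffAt]
  have h1 : deriv (fun t : ℝ => gaussBarrier K c (x + t • b)) = fun t =>
      (gaussBarrier K c (x + t • b) * (-K * (2 * ((x - c) ⬝ᵥ b) + 2 * t * (b ⬝ᵥ b)))) :=
    funext fun t => (hasDerivAt_gaussBarrier_line K c x b t).deriv
  rw [h1]
  have h2 : HasDerivAt (fun t : ℝ => -K * (2 * ((x - c) ⬝ᵥ b) + 2 * t * (b ⬝ᵥ b)))
      (-K * (2 * (b ⬝ᵥ b))) 0 := by
    have := ((((hasDerivAt_id (0:ℝ)).const_mul 2).mul_const (b ⬝ᵥ b)).const_add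
      (2 * ((x - c) ⬝ᵥ b))).const_mul (-K)
    simpa using this
  rw [((hasDerivAt_gaussBarrier_line K c x b 0).fun_mul h2).deriv]
  simp; ring

lemma ContinuousAt.sum_sq_orthogonal_part {m : ℕ} {n : (Fin m → ℝ) → (Fin m → ℝ)}
    {x₁ : Fin m → ℝ} (hn : ContinuousAt n x₁) (c : Fin m → ℝ) :
    ContinuousAt (fun x => ∑ k, ((x - c) - (n x ⬝ᵥ (x - c)) • n x) k ^ 2) x₁ := by
  have h1 : Continuous fun p : (Fin m → ℝ) × (Fin m → ℝ) =>
      ∑ k, ((p.2 - c) - (p.1 ⬝ᵥ (p.2 - c)) • p.1) k ^ 2 := by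
    simp only [dotProduct, Pi.sub_apply, Pi.smul_apply, smul_eq_mul]
    fun_prop
  have h2 : ContinuousAt (fun x => (n x, x)) x₁ := hn.prodMk continuousAt_id
  exact ContinuousAt.comp (f := fun x => (n x, x)) h1.continuousAt h2

/-- Halving the radius of an exterior ball makes it touch only at the given point. -/
lemma dotProduct_self_lt_of_midpoint {m : ℕ} {x c y : Fin m → ℝ} (hyx : y ≠ x)
    (h1 : (x - c) ⬝ᵥ (x - c) ≤ (y - c) ⬝ᵥ (y - c)) :
    (x - (1 / 2 : ℝ) • (c + x)) ⬝ᵥ (x - (1 / 2 : ℝ) • (c + x)) <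
      (y - (1 / 2 : ℝ) • (c + x)) ⬝ᵥ (y - (1 / 2 : ℝ) • (c + x)) := by
  have h2 : 0 < (y - x) ⬝ᵥ (y - x) := by
    have := norm_sq_le_dotProduct (y - x)
    have h3 : 0 < ‖y - x‖ := norm_pos_iff.2 (sub_ne_zero.2 hyx)
    have : 0 < ‖y - x‖ ^ 2 := by positivity
    linarith
  have h3 : (y - c) = (y - x) + (x - c) := by abel
  have h4 : y - (1 / 2 : ℝ) • (c + x) = (y - x) + (1 / 2 : ℝ) • (x - c) := by module
  have h5 : x - (1 / 2 : ℝ) • (c + x) = (1 / 2 : ℝ) • (x - c) := by module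
  rw [h3] at h1
  rw [h4, h5]
  simp only [add_dotProduct, dotProduct_add, smul_dotProduct, dotProduct_smul, smul_eq_mul,
    dotProduct_comm (x - c) (y - x)] at h1 ⊢
  linarith

set_option maxHeartbeats 1000000 in
/-- A touching point of a nonnegative supersolution of a degenerate elliptic inequality with
second order part in the directions orthogonal to `n`: the exterior normal is parallel to `n`. -/
lemma exterior_normal_parallel {m : ℕ} {x₁ c : Fin m → ℝ} {w : (Fin m → ℝ) → ℝ}
    {n : (Fin m → ℝ) → (Fin m → ℝ)} {C : ℝ} (hw : ContDiffAt ℝ 2 w x₁) (hw0 : w x₁ = 0)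
    (hwnn : ∀ᶠ x in 𝓝 x₁, 0 ≤ w x) (hn : ContinuousAt n x₁)
    (hn1 : ∀ᶠ x in 𝓝 x₁, n x ⬝ᵥ n x = 1)
    (hineq : ∀ᶠ x in 𝓝 x₁, ∑ k, fderiv ℝ (fderiv ℝ w) x
      (Pi.single k 1 - n x k • n x) (Pi.single k 1 - n x k • n x) ≤ C * ‖coordGrad w x‖)
    (htouch : ∀ᶠ y in 𝓝 x₁, w y = 0 → (x₁ - c) ⬝ᵥ (x₁ - c) ≤ (y - c) ⬝ᵥ (y - c)) :
    x₁ - c = (n x₁ ⬝ᵥ (x₁ - c)) • n x₁ := by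
  by_contra hne
  set c' := (1 / 2 : ℝ) • (c + x₁) with hc'
  set Q : (Fin m → ℝ) → (Fin m → ℝ) := fun x => (x - c') - (n x ⬝ᵥ (x - c')) • n x with hQ
  have hQ1 : Q x₁ ≠ 0 := by
    have h1 : x₁ - c' = (1 / 2 : ℝ) • (x₁ - c) := by
      rw [hc']; module
    have h2 : Q x₁ = (1 / 2 : ℝ) • ((x₁ - c) - (n x₁ ⬝ᵥ (x₁ - c)) • n x₁) := by
      simp only [hQ, h1, dotProduct_smul, smul_eq_mul]; module
    rw [h2]
    exact smul_ne_zero (by norm_num) (sub_ne_zero.2 hne)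
  set σ := (∑ k, Q x₁ k ^ 2) / 2 with hσ
  have hσ0 : 0 < σ := half_pos (sum_sq_pos hQ1)
  have hQc : ContinuousAt (fun x => ∑ k, Q x k ^ 2) x₁ := hn.sum_sq_orthogonal_part c'
  have hσev : ∀ᶠ x in 𝓝 x₁, σ < ∑ k, Q x k ^ 2 :=
    hQc.eventually (lt_mem_nhds (by
      change (∑ k, Q x₁ k ^ 2) / 2 < ∑ k, Q x₁ k ^ 2
      have := sum_sq_pos hQ1; linarith))
  set M := ‖x₁ - c'‖ + 1 with hM
  have hMev : ∀ᶠ x in 𝓝 x₁, ‖x - c'‖ < M := by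
    have : ContinuousAt (fun x => ‖x - c'‖) x₁ := by fun_prop
    exact this.eventually (gt_mem_nhds (by simp [hM]))
  have hM0 : 0 < M := by positivity
  set K := (m + |C| * M + 1) / σ with hK
  have hK0 : 0 < K := by positivity
  have hstrict : ∀ᶠ y in 𝓝 x₁, w y = 0 → y ≠ x₁ →
      (x₁ - c') ⬝ᵥ (x₁ - c') < (y - c') ⬝ᵥ (y - c') := by
    filter_upwards [htouch] with y hy hwy hyx using
      dotProduct_self_lt_of_midpoint hyx (hy hwy)
  obtain ⟨r, hr, hball⟩ := nhds_basis_closedBall.eventually_iff.1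
    ((hw.eventually (by simp)).and (hwnn.and (hn1.and (hineq.and (hσev.and (hMev.and hstrict))))))
  set h := gaussBarrier K c' with hh
  have hhc : Continuous h := (contDiff_gaussBarrier K c' (n := 0)).continuous
  have hwc : ContinuousOn w (closedBall x₁ r) := fun x hx =>
    (hball hx).1.continuousAt.continuousWithinAt
  have hsph : sphere x₁ r ⊆ closedBall x₁ r := sphere_subset_closedBall
  -- lower bound on the part of the sphere where the barrier is large
  obtain ⟨τ, hτ0, hτ⟩ : ∃ τ > 0, ∀ x ∈ sphere x₁ r,
      (x - c') ⬝ᵥ (x - c') ≤ (x₁ - c') ⬝ᵥ (x₁ - c') → τ ≤ w x := by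
    have hcomp : IsCompact (sphere x₁ r ∩
        {x | (x - c') ⬝ᵥ (x - c') ≤ (x₁ - c') ⬝ᵥ (x₁ - c')}) :=
      (isCompact_sphere x₁ r).inter_right (isClosed_le (by unfold dotProduct; fun_prop) (by fun_prop))
    rcases (sphere x₁ r ∩
        {x | (x - c') ⬝ᵥ (x - c') ≤ (x₁ - c') ⬝ᵥ (x₁ - c')}).eq_empty_or_nonempty with he | hne
    · refine ⟨1, one_pos, fun x hx hx' => ?_⟩
      have : x ∈ (∅ : Set (Fin m → ℝ)) := he ▸ ⟨hx, hx'⟩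
      exact this.elim
    · obtain ⟨z, hz, hmin⟩ := hcomp.exists_isMinOn hne
        (hwc.mono (Set.inter_subset_left.trans hsph))
      refine ⟨w z, ?_, fun x hx hx' => hmin ⟨hx, hx'⟩⟩
      have hzb := hball (hsph hz.1)
      refine lt_of_le_of_ne hzb.2.1 fun h0 => ?_
      have hzx : z ≠ x₁ := by
        rintro rfl
        have := hz.1
        rw [mem_sphere, dist_self] at this
        exact hr.ne this
      have := hzb.2.2.2.2.2.2 h0.symm hzx
      exact absurd hz.2 (not_le.2 this)
  set ψ : (Fin m → ℝ) → ℝ := fun x => w x - τ * h x with hψ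
  have hψs : ∀ x ∈ sphere x₁ r, ψ x₁ ≤ ψ x := by
    intro x hx
    simp only [hψ, hw0]
    by_cases hq : (x - c') ⬝ᵥ (x - c') ≤ (x₁ - c') ⬝ᵥ (x₁ - c')
    · have h1 := hτ x hx hq
      have h2 : h x ≤ 1 := by
        simp only [hh, gaussBarrier, Real.exp_le_one_iff]
        have : 0 ≤ (x - c') ⬝ᵥ (x - c') := (sq_nonneg _).trans (norm_sq_le_dotProduct _)
        nlinarith
      have h3 : 0 < h x₁ := Real.exp_pos _
      nlinarith
    · push Not at hq
      have h1 : h x ≤ h x₁ := by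
        simp only [hh, gaussBarrier, Real.exp_le_exp]
        nlinarith
      have h2 := (hball (hsph hx)).2.1
      nlinarith
  obtain ⟨x₂, hx₂, hmin⟩ : ∃ x₂ ∈ ball x₁ r, IsLocalMin ψ x₂ := by
    obtain ⟨z, hz, hmin⟩ := (isCompact_closedBall x₁ r).exists_isMinOn
      ⟨x₁, mem_closedBall_self hr.le⟩ (hwc.sub (hhc.const_mul τ).continuousOn : ContinuousOn ψ _)
    rcases (mem_closedBall.1 hz).lt_or_eq with h1 | h1
    · exact ⟨z, h1, hmin.isLocalMin (closedBall_mem_nhds_of_mem h1)⟩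
    · refine ⟨x₁, mem_ball_self hr, ?_⟩
      filter_upwards [closedBall_mem_nhds x₁ hr] with y hy
      exact (hψs z h1).trans (hmin hy)
  obtain ⟨hb1, -, hb3, hb4, hb5, hb6, -⟩ := hball (ball_subset_closedBall hx₂)
  have hcd : ContDiffAt ℝ 2 h x₂ := (contDiff_gaussBarrier K c').contDiffAt
  have hψcd : ContDiffAt ℝ 2 ψ x₂ := hb1.sub (contDiffAt_const.mul hcd)
  have hfd : ∀ᶠ x in 𝓝 x₂, fderiv ℝ ψ x = fderiv ℝ w x - τ • fderiv ℝ h x := by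
    filter_upwards [hb1.eventually (by simp), hcd.eventually (by simp)] with x h1 h2
    have h3 := h1.differentiableAt two_ne_zero
    have h4 := h2.differentiableAt two_ne_zero
    exact (h3.hasFDerivAt.sub (h4.hasFDerivAt.const_mul τ)).fderiv
  have hcg : coordGrad w x₂ = -(τ * (2 * K * h x₂)) • (x₂ - c') := by
    have h1 := hfd.self_of_nhds
    rw [hmin.fderiv_eq_zero] at h1
    have h2 : fderiv ℝ w x₂ = τ • fderiv ℝ h x₂ := (sub_eq_zero.1 h1.symm)
    ext i
    simp only [coordGrad, h2, _root_.smul_apply, hh, fderiv_gaussBarrier]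
    simp
    ring
  have hfd2 : fderiv ℝ (fderiv ℝ ψ) x₂ = fderiv ℝ (fderiv ℝ w) x₂ - τ • fderiv ℝ (fderiv ℝ h) x₂ := by
    rw [Filter.EventuallyEq.fderiv_eq hfd]
    have h3 := (hb1.fderiv_right (m := 1) (by norm_num)).differentiableAt one_ne_zero
    have h4 := (hcd.fderiv_right (m := 1) (by norm_num)).differentiableAt one_ne_zero
    exact (h3.hasFDerivAt.sub (h4.hasFDerivAt.const_smul τ)).fderiv
  set b : Fin m → Fin m → ℝ := fun k => Pi.single k 1 - n x₂ k • n x₂ with hb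
  have hge : ∀ k, τ * (h x₂ * (4 * K ^ 2 * ((x₂ - c') ⬝ᵥ b k) ^ 2 - 2 * K * (b k ⬝ᵥ b k))) ≤
      fderiv ℝ (fderiv ℝ w) x₂ (b k) (b k) := by
    intro k
    have h1 := hmin.fderiv_fderiv_nonneg hψcd (b k)
    rw [hfd2] at h1
    have h2 : (fderiv ℝ (fderiv ℝ w) x₂ - τ • fderiv ℝ (fderiv ℝ h) x₂) (b k) (b k)
      = fderiv ℝ (fderiv ℝ w) x₂ (b k) (b k) - τ * fderiv ℝ (fderiv ℝ h) x₂ (b k) (b k) := rfl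
    rw [h2, hh, fderiv_fderiv_gaussBarrier] at h1
    linarith
  have hyb : ∀ k, (x₂ - c') ⬝ᵥ b k = Q x₂ k := by
    intro k
    simp only [hb, hQ]
    rw [dotProduct_sub, dotProduct_smul, dotProduct_comm (n x₂) (x₂ - c')]
    simp only [dotProduct_single, smul_eq_mul, Pi.sub_apply, Pi.smul_apply, mul_one]
    ring
  have hbb : ∀ k, b k ⬝ᵥ b k ≤ 1 := by
    intro k
    simp only [hb, dotProduct_sub, sub_dotProduct, dotProduct_smul, smul_dotProduct,
      dotProduct_single, single_dotProduct, smul_eq_mul, hb3, Pi.sub_apply, Pi.smul_apply,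
      Pi.single_eq_same, mul_one, one_mul]
    nlinarith [sq_nonneg (n x₂ k)]
  have h0 : 0 < h x₂ := Real.exp_pos _
  have hsum : τ * (h x₂ * (4 * K ^ 2 * σ - 2 * K * m)) ≤ C * ‖coordGrad w x₂‖ := by
    refine le_trans ?_ hb4
    refine le_trans ?_ (Finset.sum_le_sum fun k _ => hge k)
    simp only [hyb]
    rw [← Finset.mul_sum, ← Finset.mul_sum, Finset.sum_sub_distrib, ← Finset.mul_sum,
      ← Finset.mul_sum]
    have h1 : ∑ k, b k ⬝ᵥ b k ≤ m := by
      have := Finset.sum_le_sum fun k (_ : k ∈ Finset.univ) => hbb k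
      simpa using this
    gcongr
  have hC : C * ‖coordGrad w x₂‖ ≤ |C| * (τ * (2 * K * h x₂) * M) := by
    rw [hcg, norm_smul, norm_neg, Real.norm_of_nonneg (by positivity)]
    have := le_abs_self C
    gcongr
  have hKσ : K * σ = m + |C| * M + 1 := by rw [hK]; field_simp
  have hfin : τ * h x₂ * (2 * K) * (2 * (K * σ) - m - |C| * M) ≤ 0 := by nlinarith
  rw [hKσ] at hfin
  have : 0 < τ * h x₂ * (2 * K) * (2 * (m + |C| * M + 1) - m - |C| * M) := by
    have h5 : (0:ℝ) < 2 * (m + |C| * M + 1) - m - |C| * M := by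
      have : 0 ≤ |C| * M := by positivity
      have : (0:ℝ) ≤ m := by positivity
      linarith
    positivity
  linarith

lemma sum_smul_single {m : ℕ} (n : Fin m → ℝ) : ∑ k, n k • (Pi.single k 1 : Fin m → ℝ) = n := by
  ext i; simp [Finset.sum_apply, Pi.single_apply]

lemma sum_bilin_orthogonal {m : ℕ} (B : (Fin m → ℝ) →L[ℝ] (Fin m → ℝ) →L[ℝ] ℝ) {n : Fin m → ℝ}
    (hn : n ⬝ᵥ n = 1) :
    ∑ k, B (Pi.single k 1 - n k • n) (Pi.single k 1 - n k • n) =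
      ∑ i, (B (Pi.single i 1) (Pi.single i 1)
        - n i * ∑ k, n k * B (Pi.single i 1) (Pi.single k 1)) := by
  have h1 : ∀ a, ∑ k, n k * B a (Pi.single k 1) = B a n := by
    intro a
    conv_rhs => rw [← sum_smul_single n]
    simp [map_sum]
  have h2 : ∀ a, ∑ k, n k * B (Pi.single k 1) a = B n a := by
    intro a
    conv_rhs => rw [← sum_smul_single n]
    simp only [map_sum, map_smul, _root_.sum_apply, _root_.smul_apply, smul_eq_mul]
  simp only [h1, map_sub, map_smul, _root_.sub_apply, _root_.smul_apply, smul_eq_mul]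
  have h3 : ∑ k, n k * (n k * B n n) = B n n := by
    calc _ = (n ⬝ᵥ n) * B n n := by
          rw [dotProduct, Finset.sum_mul]
          exact Finset.sum_congr rfl fun k _ => by ring
      _ = _ := by rw [hn, one_mul]
  have h4 : ∀ k, B (Pi.single k 1) (Pi.single k 1) - n k * B n (Pi.single k 1)
      - n k * (B (Pi.single k 1) n - n k * B n n) = (B (Pi.single k 1) (Pi.single k 1)
        - n k * B (Pi.single k 1) n) - n k * B n (Pi.single k 1) + n k * (n k * B n n) := by
    intro k; ring
  simp only [h4, Finset.sum_add_distrib, h3]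
  rw [Finset.sum_sub_distrib, h1]
  ring

lemma fderiv_coordGrad_apply {m : ℕ} {w : (Fin m → ℝ) → ℝ} {x : Fin m → ℝ}
    (hw : ContDiffAt ℝ 2 w x) (a : Fin m → ℝ) (i : Fin m) :
    fderiv ℝ (coordGrad w) x a i = fderiv ℝ (fderiv ℝ w) x a (Pi.single i 1) := by
  have h1 := (contDiffAt_coordGrad hw).differentiableAt one_ne_zero
  have h2 : DifferentiableAt ℝ (fderiv ℝ w) x :=
    (hw.fderiv_right (m := 1) (by norm_num)).differentiableAt one_ne_zero
  have h3 := (hasFDerivAt_pi'.1 h1.hasFDerivAt i).fderiv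
  have h4 : HasFDerivAt (fun y => coordGrad w y i) _ x :=
    h2.hasFDerivAt.clm_apply (hasFDerivAt_const (Pi.single i 1 : Fin m → ℝ) x)
  rw [h4.fderiv] at h3
  have := congrArg (fun T => T a) h3
  simpa using this.symm

lemma coordGrad_sub {m : ℕ} {u v : (Fin m → ℝ) → ℝ} {x : Fin m → ℝ}
    (hu : DifferentiableAt ℝ u x) (hv : DifferentiableAt ℝ v x) :
    coordGrad (fun y => v y - u y) x = coordGrad v x - coordGrad u x := by
  ext i
  simp [coordGrad, fderiv_fun_sub hv hu]

lemma sum_fderiv_euclNormalize {m : ℕ} {w : (Fin m → ℝ) → ℝ} {x g : Fin m → ℝ}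
    (hw : ContDiffAt ℝ 2 w x) (hg : g ≠ 0) :
    ∑ k, fderiv ℝ (fderiv ℝ w) x (Pi.single k 1 - euclNormalize g k • euclNormalize g)
        (Pi.single k 1 - euclNormalize g k • euclNormalize g) =
      Real.sqrt (∑ k, g k ^ 2) * ∑ i, fderiv ℝ euclNormalize g
        (fderiv ℝ (coordGrad w) x (Pi.single i 1)) i := by
  have h0 : Real.sqrt (∑ k, g k ^ 2) ≠ 0 := (Real.sqrt_pos.2 (sum_sq_pos hg)).ne'
  rw [sum_bilin_orthogonal _ (euclNormalize_dotProduct_self hg)]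
  simp only [fderiv_euclNormalize hg]
  rw [Finset.mul_sum]
  refine Finset.sum_congr rfl fun i _ => ?_
  rw [mul_div_cancel₀ _ h0]
  simp only [dotProduct, fderiv_coordGrad_apply hw]

lemma eventually_degenerate_elliptic_ineq {m : ℕ} {F : (Fin m → ℝ) → (Fin m → ℝ)}
    {u v : (Fin m → ℝ) → ℝ} {x₁ : Fin m → ℝ} (hF : ContDiffAt ℝ 1 F x₁)
    (hu : ContDiffAt ℝ 2 u x₁) (hv : ContDiffAt ℝ 2 v x₁) (h0 : gradF m F u x₁ ≠ 0)
    (huv : gradF m F v x₁ = gradF m F u x₁)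
    (hH : ∀ᶠ x in 𝓝 x₁, Hmc m F v x ≤ Hmc m F u x) :
    ∃ C : ℝ, ∀ᶠ x in 𝓝 x₁, ∑ k, fderiv ℝ (fderiv ℝ fun y => v y - u y) x
      (Pi.single k 1 - legN m F u x k • legN m F u x)
      (Pi.single k 1 - legN m F u x k • legN m F u x) ≤ C * ‖coordGrad (fun y => v y - u y) x‖ := by
  set Gu := gradF m F u with hGu
  set Gv := gradF m F v with hGv
  set L := fderiv ℝ (euclNormalize (m := m)) with hL
  have hGuc := contDiffAt_gradF hF hu
  have hGvc := contDiffAt_gradF hF hv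
  have hLc : ContDiffAt ℝ 1 L (Gu x₁) :=
    (contDiffAt_euclNormalize h0 (n := 2)).fderiv_right (by norm_num)
  obtain ⟨κ, N, hN, hlip⟩ := hLc.exists_lipschitzOnWith
  have hDc : ContinuousAt (fun x => ‖fderiv ℝ Gv x‖) x₁ :=
    (hGvc.continuousAt_fderiv one_ne_zero).norm
  have hRc : ContinuousAt (fun x => Real.sqrt (∑ k, Gu x k ^ 2)) x₁ := by
    have : Continuous fun g : Fin m → ℝ => Real.sqrt (∑ k, g k ^ 2) := by fun_prop
    exact this.continuousAt.comp hGuc.continuousAt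
  set B := ‖fderiv ℝ Gv x₁‖ + 1 with hB
  set R := Real.sqrt (∑ k, Gu x₁ k ^ 2) + 1 with hR
  have hR0 : 0 ≤ R := by positivity
  refine ⟨R * (m * (κ * B)), ?_⟩
  have hne : ∀ᶠ x in 𝓝 x₁, Gu x ≠ 0 := hGuc.continuousAt.eventually_ne h0
  have hne' : ∀ᶠ x in 𝓝 x₁, Gv x ≠ 0 := hGvc.continuousAt.eventually_ne (by rw [← hGv, huv]; exact h0)
  filter_upwards [hH, hF.eventually (by simp), hu.eventually (by simp), hv.eventually (by simp),
    hne, hne', hGuc.continuousAt.eventually hN, hGvc.continuousAt.eventually (huv ▸ hN),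
    hDc.eventually (gt_mem_nhds (lt_add_one _)), hRc.eventually (gt_mem_nhds (lt_add_one _)),
    (hu.eventually (by simp)).eventually_nhds, (hv.eventually (by simp)).eventually_nhds]
    with x hHx hFx hux hvx hnu hnv hNu hNv hDx hRx huxx hvxx
  have hw : ContDiffAt ℝ 2 (fun y => v y - u y) x := hvx.sub hux
  simp only [legN_eq, ← hGu]
  rw [sum_fderiv_euclNormalize hw hnu]
  have hcg : coordGrad (fun y => v y - u y) =ᶠ[𝓝 x] fun y => Gv y - Gu y := by
    filter_upwards [huxx, hvxx] with y h1 h2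
    rw [coordGrad_sub (h1.differentiableAt two_ne_zero) (h2.differentiableAt two_ne_zero),
      hGv, hGu, gradF_eq, gradF_eq]
    exact (add_sub_add_right_eq_sub _ _ _).symm
  have hGud := (contDiffAt_gradF hFx hux).differentiableAt one_ne_zero
  have hGvd := (contDiffAt_gradF hFx hvx).differentiableAt one_ne_zero
  have hfd : fderiv ℝ (coordGrad fun y => v y - u y) x = fderiv ℝ Gv x - fderiv ℝ Gu x := by
    rw [hcg.fderiv_eq]
    exact (hGvd.hasFDerivAt.sub hGud.hasFDerivAt).fderiv
  rw [hcg.self_of_nhds, hfd]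
  rw [Hmc_eq hFx hvx hnv, Hmc_eq hFx hux hnu] at hHx
  have hsum : ∑ i, L (Gu x) ((fderiv ℝ Gv x - fderiv ℝ Gu x) (Pi.single i 1)) i ≤
      ∑ i, ((L (Gu x) - L (Gv x)) (fderiv ℝ Gv x (Pi.single i 1))) i := by
    simp only [_root_.sub_apply, map_sub, Pi.sub_apply, Finset.sum_sub_distrib]
    linarith
  have hbd : ∀ i : Fin m, ((L (Gu x) - L (Gv x)) (fderiv ℝ Gv x (Pi.single i 1))) i ≤
      κ * B * ‖Gv x - Gu x‖ := by
    intro i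
    have h1 : ‖L (Gu x) - L (Gv x)‖ ≤ κ * ‖Gu x - Gv x‖ := hlip.norm_sub_le hNu hNv
    have h2 : ‖fderiv ℝ Gv x (Pi.single i 1)‖ ≤ B := by
      have h3 := (fderiv ℝ Gv x).le_opNorm (Pi.single i 1)
      have h4 : ‖(Pi.single i 1 : Fin m → ℝ)‖ = 1 := by simp [Pi.norm_single]
      rw [h4, mul_one] at h3
      exact h3.trans hDx.le
    calc ((L (Gu x) - L (Gv x)) (fderiv ℝ Gv x (Pi.single i 1))) i
        ≤ ‖((L (Gu x) - L (Gv x)) (fderiv ℝ Gv x (Pi.single i 1))) i‖ := Real.le_norm_self _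
      _ ≤ ‖(L (Gu x) - L (Gv x)) (fderiv ℝ Gv x (Pi.single i 1))‖ := norm_le_pi_norm _ i
      _ ≤ ‖L (Gu x) - L (Gv x)‖ * ‖fderiv ℝ Gv x (Pi.single i 1)‖ :=
          ContinuousLinearMap.le_opNorm _ _
      _ ≤ κ * ‖Gu x - Gv x‖ * B := by gcongr
      _ = κ * B * ‖Gv x - Gu x‖ := by rw [norm_sub_rev]; ring
  have hsum2 := hsum.trans (Finset.sum_le_sum fun i _ => hbd i)
  rw [Finset.sum_const, Finset.card_univ, Fintype.card_fin, nsmul_eq_mul] at hsum2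
  calc _ ≤ Real.sqrt (∑ k, Gu x k ^ 2) * (m * (κ * B * ‖Gv x - Gu x‖)) := by gcongr
    _ ≤ R * (m * (κ * B * ‖Gv x - Gu x‖)) := by gcongr
    _ = _ := by ring

lemma LieSpan.mono {m : ℕ} {U U' : Set (Fin m → ℝ)} {S : Set ((Fin m → ℝ) → (Fin m → ℝ))}
    (h : U' ⊆ U) {X : (Fin m → ℝ) → (Fin m → ℝ)} (hX : LieSpan U S X) : LieSpan U' S X := by
  induction hX with
  | base X hX => exact .base X hX
  | smul f X hf _ ih => exact .smul f X (hf.mono h) ih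
  | add X Y _ _ ihX ihY => exact .add X Y ihX ihY
  | bracket X Y _ _ ihX ihY => exact .bracket X Y ihX ihY

lemma isOpen_setOf_lt_of_contDiffOn {m : ℕ} {Ω : Set (Fin m → ℝ)} (hΩ : IsOpen Ω)
    {u v : (Fin m → ℝ) → ℝ} (hu : ContDiffOn ℝ 2 u Ω) (hv : ContDiffOn ℝ 2 v Ω) :
    IsOpen {x | x ∈ Ω ∧ u x < v x} := by
  have := (hv.continuousOn.sub hu.continuousOn).isOpen_inter_preimage hΩ (isOpen_Ioi (a := (0:ℝ)))
  have he : {x | x ∈ Ω ∧ u x < v x} = Ω ∩ (v - u) ⁻¹' Set.Ioi 0 :=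
    Set.ext fun x => ⟨fun h => ⟨h.1, sub_pos.2 h.2⟩, fun h => ⟨h.1, sub_pos.1 h.2⟩⟩
  rwa [he]

lemma gradF_eq_of_touch {m : ℕ} {Ω : Set (Fin m → ℝ)} (hΩ : IsOpen Ω)
    {F : (Fin m → ℝ) → (Fin m → ℝ)} {u v : (Fin m → ℝ) → ℝ}
    (hu : ContDiffOn ℝ 2 u Ω) (hv : ContDiffOn ℝ 2 v Ω) (hvu : ∀ x ∈ Ω, u x ≤ v x)
    {z : Fin m → ℝ} (hz : z ∈ Ω) (htouch : v z = u z) : gradF m F v z = gradF m F u z := by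
  have hzN := hΩ.mem_nhds hz
  have hmin : IsLocalMin (fun y => v y - u y) z := by
    filter_upwards [hzN] with y hy
    have := hvu y hy
    simp only [htouch]; linarith
  have h1 := coordGrad_sub ((hu.contDiffAt hzN).differentiableAt two_ne_zero)
    ((hv.contDiffAt hzN).differentiableAt two_ne_zero)
  have h2 : coordGrad (fun y => v y - u y) z = 0 := by
    ext i; simp [coordGrad, hmin.fderiv_eq_zero]
  rw [h2] at h1
  rw [gradF_eq, gradF_eq]
  simp only [sub_eq_zero.1 h1.symm]

lemma coincidence_mem_nhds {m : ℕ} {Ω : Set (Fin m → ℝ)} (hΩ : IsOpen Ω)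
    {F : (Fin m → ℝ) → (Fin m → ℝ)} (hF : ContDiffOn ℝ 1 F Ω) {u v : (Fin m → ℝ) → ℝ}
    (hu : ContDiffOn ℝ 2 u Ω) (hv : ContDiffOn ℝ 2 v Ω) (hvu : ∀ x ∈ Ω, u x ≤ v x)
    {p₀ : Fin m → ℝ} (hS : SingSet m Ω F u = {p₀})
    (hH : ∀ x ∈ Ω \ ({p₀} ∪ SingSet m Ω F v), Hmc m F v x ≤ Hmc m F u x)
    {p : Fin m → ℝ} (hp : p ∈ Ω \ {p₀}) {U : Set (Fin m → ℝ)} (hU : IsOpen U) (hpU : p ∈ U)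
    (hUΩ : U ⊆ Ω) (hframe : GoodFrame m U F u) (hpt : v p = u p) :
    {x | x ∈ Ω ∧ v x = u x} ∈ 𝓝 p := by
  obtain ⟨Nw, hsm, -, hort, hspan⟩ := hframe
  set Z := {x | x ∈ Ω ∧ v x = u x} with hZdef
  have hU' : IsOpen (U \ {p₀}) := hU.sdiff isClosed_singleton
  have hne0 : ∀ z ∈ Ω, z ≠ p₀ → gradF m F u z ≠ 0 := fun z hz hzp h0 => by
    have : z ∈ SingSet m Ω F u := ⟨hz, h0⟩
    rw [hS] at this
    exact hzp this
  refine mem_nhds_of_lieSpan_tangentTo (S := Set.range Nw) hU' ?_ ?_ ?_ ?_ ⟨hpU, hp.2⟩ ⟨hp.1, hpt⟩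
  · rintro _ ⟨α, rfl⟩
    exact (hsm α).mono Set.sdiff_subset
  · rintro _ ⟨α, rfl⟩ z hzU hzZ c hc
    have hzΩ := hzZ.1
    have hzN := hΩ.mem_nhds hzΩ
    have hFz := hF.contDiffAt hzN
    have huz := hu.contDiffAt hzN
    have hvz := hv.contDiffAt hzN
    have hg0 := hne0 z hzΩ hzU.2
    have hguv := gradF_eq_of_touch (F := F) hΩ hu hv hvu hzΩ hzZ.2
    have hguc := (contDiffAt_gradF hFz huz).continuousAt
    have hgvc := (contDiffAt_gradF hFz hvz).continuousAt
    have hHz : ∀ᶠ x in 𝓝 z, Hmc m F v x ≤ Hmc m F u x := by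
      filter_upwards [hzN, hgvc.eventually_ne (hguv ▸ hg0),
        isOpen_compl_singleton.mem_nhds hzU.2] with x hx hxv hxp
      refine hH x ⟨hx, ?_⟩
      rintro (h | h)
      · exact hxp h
      · exact hxv h.2
    obtain ⟨C, hC⟩ := eventually_degenerate_elliptic_ineq hFz huz hvz hg0 hguv hHz
    have hn1 : ∀ᶠ x in 𝓝 z, legN m F u x ⬝ᵥ legN m F u x = 1 := by
      filter_upwards [hguc.eventually_ne hg0] with x hx
      rw [legN_eq]; exact euclNormalize_dotProduct_self hx
    have hnc : ContinuousAt (legN m F u) z :=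
      ContinuousAt.comp (g := euclNormalize) (contDiffAt_euclNormalize hg0 (n := 0)).continuousAt hguc
    have hpar := exterior_normal_parallel (w := fun y => v y - u y) (c := c) (hvz.sub huz)
      (sub_eq_zero.2 hzZ.2)
      (by filter_upwards [hzN] with x hx using sub_nonneg.2 (hvu x hx)) hnc hn1 hC
      (by filter_upwards [hc, hzN] with y hy hyΩ h0 using hy ⟨hyΩ, sub_eq_zero.1 h0⟩)
    rw [hpar, dotProduct_smul]
    have : Nw α z ⬝ᵥ legN m F u z = 0 := hort z hzU.1 α
    rw [this, smul_zero]
  · rintro z ⟨hzU, -⟩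
    obtain ⟨R, hR, hsub⟩ := nhds_basis_closedBall.mem_iff.1 (hΩ.mem_nhds (hUΩ hzU))
    refine ⟨R, hR, ?_⟩
    have h1 := ((hv.continuousOn.sub hu.continuousOn).mono hsub).preimage_isClosed_of_isClosed
      isClosed_closedBall (isClosed_singleton (x := (0:ℝ)))
    have he : Z ∩ closedBall z R = closedBall z R ∩ (v - u) ⁻¹' {0} :=
      Set.ext fun x => ⟨fun h => ⟨h.2, sub_eq_zero.2 h.1.2⟩,
        fun h => ⟨⟨hsub h.1, sub_eq_zero.1 h.2⟩, h.1⟩⟩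
    rwa [he]
  · intro x hx
    refine top_unique ((hspan x hx.1).symm.le.trans (Submodule.span_mono ?_))
    rintro _ ⟨X, hX, rfl⟩
    exact ⟨X, hX.mono Set.sdiff_subset, rfl⟩

lemma eqOn_of_coincidence_isOpen {m : ℕ} (hm : 3 ≤ m) {Ω : Set (Fin m → ℝ)} (hΩ : IsOpen Ω)
    (hΩc : IsConnected Ω) {u v : (Fin m → ℝ) → ℝ}
    (hu : ContDiffOn ℝ 2 u Ω) (hv : ContDiffOn ℝ 2 v Ω) (hvu : ∀ x ∈ Ω, u x ≤ v x)
    {p₀ : Fin m → ℝ} (hp₀ : p₀ ∈ Ω) (htouch : v p₀ = u p₀)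
    (hopen : ∀ p ∈ Ω, p ≠ p₀ → v p = u p → {x | x ∈ Ω ∧ v x = u x} ∈ 𝓝 p)
    (hsphere : ∀ r > 0, closedBall p₀ r ⊆ Ω → ¬ ∀ x ∈ sphere p₀ r, u x < v x) :
    ∀ x ∈ Ω, v x = u x := by
  set Z := {x | x ∈ Ω ∧ v x = u x} with hZ
  have hb := isOpen_setOf_lt_of_contDiffOn hΩ hu hv
  have hrank : 1 < Module.rank ℝ (Fin m → ℝ) := by
    rw [rank_fin_fun]; exact_mod_cast (by omega : 1 < m)
  have hp0 : Z ∈ 𝓝 p₀ := by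
    obtain ⟨R, hR, hsub⟩ := nhds_basis_closedBall.mem_iff.1 (hΩ.mem_nhds hp₀)
    refine Filter.mem_of_superset (closedBall_mem_nhds p₀ hR) fun x hx => ?_
    rcases eq_or_ne x p₀ with rfl | hxp
    · exact ⟨hp₀, htouch⟩
    set r := dist x p₀ with hr
    have hr0 : 0 < r := dist_pos.2 hxp
    have hrR : closedBall p₀ r ⊆ Ω := (closedBall_subset_closedBall hx).trans hsub
    have hsr : sphere p₀ r ⊆ Ω := sphere_subset_closedBall.trans hrR
    have hsne : ∀ y ∈ sphere p₀ r, y ≠ p₀ := by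
      rintro y hy rfl
      rw [mem_sphere, dist_self] at hy
      exact hr0.ne hy
    have h1 := hsphere r hr0 hrR
    push Not at h1
    obtain ⟨y, hy, hyle⟩ := h1
    refine ⟨hsub hx, ?_⟩
    by_contra hne
    have hlt : u x < v x := lt_of_le_of_ne (hvu x (hsub hx)) (Ne.symm hne)
    obtain ⟨z, -, hz1, hz2⟩ := isPreconnected_sphere hrank p₀ r (interior Z) _ isOpen_interior hb
      (fun z hz => by
        rcases (hvu z (hsr hz)).lt_or_eq with h | h
        · exact Or.inr ⟨hsr hz, h⟩
        · exact Or.inl (mem_interior_iff_mem_nhds.2 (hopen z (hsr hz) (hsne z hz) h.symm)))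
      ⟨y, hy, mem_interior_iff_mem_nhds.2 (hopen y (hsr hy) (hsne y hy)
        (le_antisymm hyle (hvu y (hsr hy))))⟩ ⟨x, rfl, hsub hx, hlt⟩
    exact hz2.2.ne' (interior_subset hz1).2
  intro x hx
  by_contra hne
  have hlt : u x < v x := lt_of_le_of_ne (hvu x hx) (Ne.symm hne)
  obtain ⟨z, -, hz1, hz2⟩ := hΩc.isPreconnected (interior Z) _ isOpen_interior hb
    (fun z hz => by
      rcases (hvu z hz).lt_or_eq with h | h
      · exact Or.inr ⟨hz, h⟩
      · refine Or.inl (mem_interior_iff_mem_nhds.2 ?_)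
        rcases eq_or_ne z p₀ with rfl | hzp
        · exact hp0
        · exact hopen z hz hzp h.symm)
    ⟨p₀, hp₀, mem_interior_iff_mem_nhds.2 hp0⟩ ⟨x, hx, hx, hlt⟩
  exact hz2.2.ne' (interior_subset hz1).2

lemma integrable_fderiv_of_hasCompactSupport {m : ℕ} {f : (Fin m → ℝ) → ℝ} (hf : ContDiff ℝ 1 f)
    (hc : HasCompactSupport f) (a : Fin m → ℝ) : Integrable fun x => fderiv ℝ f x a :=
  ((hf.continuous_fderiv one_ne_zero).clm_apply continuous_const).integrable_of_hasCompactSupport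
    (hc.fderiv_apply ℝ a)

lemma integral_fderiv_eq_zero_of_hasCompactSupport {m : ℕ} {f : (Fin m → ℝ) → ℝ}
    (hf : ContDiff ℝ 1 f) (hc : HasCompactSupport f) (a : Fin m → ℝ) :
    ∫ x, fderiv ℝ f x a = 0 := by
  have h := integral_mul_fderiv_eq_neg_fderiv_mul_of_integrable (μ := volume)
    (f := fun _ : Fin m → ℝ => (1 : ℝ)) (g := f) (v := a) (by simp)
    (by simpa using integrable_fderiv_of_hasCompactSupport hf hc a)
    (by simpa using hf.continuous.integrable_of_hasCompactSupport hc)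
    (fun x _ => differentiableAt_const _) (fun x _ => hf.differentiable one_ne_zero x)
  simpa using h

lemma hasDerivAt_max_zero_sq (t : ℝ) : HasDerivAt (fun t : ℝ => (max t 0) ^ 2) (2 * max t 0) t := by
  rcases lt_trichotomy t 0 with h | rfl | h
  · have : (fun t : ℝ => (max t 0) ^ 2) =ᶠ[𝓝 t] fun _ => 0 := by
      filter_upwards [gt_mem_nhds h] with s hs
      simp [max_eq_right hs.le]
    rw [max_eq_right h.le, mul_zero]
    exact (hasDerivAt_const t (0:ℝ)).congr_of_eventuallyEq this
  · rw [hasDerivAt_iff_isLittleO]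
    have h1 : (fun t : ℝ => t ^ 2) =o[𝓝 0] fun t => t := by
      simpa using isLittleO_pow_pow (𝕜 := ℝ) (m := 1) (n := 2) one_lt_two
    simp only [max_self, mul_zero, smul_zero, sub_zero, ne_eq, OfNat.ofNat_ne_zero,
      not_false_eq_true, zero_pow]
    refine IsBigO.trans_isLittleO (IsBigO.of_bound 1 (Eventually.of_forall fun s => ?_)) h1
    rw [one_mul, Real.norm_of_nonneg (by positivity), Real.norm_of_nonneg (by positivity)]
    rcases le_total s 0 with h | h
    · simp [max_eq_right h]; positivity
    · simp [max_eq_left h]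
  · have : (fun t : ℝ => (max t 0) ^ 2) =ᶠ[𝓝 t] fun t => t ^ 2 := by
      filter_upwards [lt_mem_nhds h] with s hs
      simp [max_eq_left hs.le]
    rw [max_eq_left h.le]
    have h2 : HasDerivAt (fun t : ℝ => t ^ 2) (2 * t) t := by simpa using hasDerivAt_pow 2 t
    exact h2.congr_of_eventuallyEq this

lemma contDiff_max_zero_sq : ContDiff ℝ 1 fun t : ℝ => (max t 0) ^ 2 := by
  rw [contDiff_one_iff_deriv]
  refine ⟨fun t => (hasDerivAt_max_zero_sq t).differentiableAt, ?_⟩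
  have : deriv (fun t : ℝ => (max t 0) ^ 2) = fun t => 2 * max t 0 :=
    funext fun t => (hasDerivAt_max_zero_sq t).deriv
  rw [this]
  fun_prop

/-- A compact set of vanishing Hausdorff measure is covered by finitely many small balls with
small total `d`-dimensional content. -/
lemma exists_finite_ball_cover {m : ℕ} {K : Set (Fin m → ℝ)} (hK : IsCompact K) {d : ℝ}
    (hd : 0 < d) (hμ : μH[d] K = 0) {ρ δ : ℝ} (hρ : 0 < ρ) (hδ : 0 < δ) :
    ∃ (s : Finset ℕ) (x : ℕ → Fin m → ℝ) (r : ℕ → ℝ), (∀ n ∈ s, x n ∈ K ∧ 0 < r n ∧ r n < ρ) ∧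
      K ⊆ ⋃ n ∈ s, ball (x n) (r n) ∧ ∑ n ∈ s, r n ^ d ≤ δ := by
  classical
  have hlt : μH[d] K < ENNReal.ofReal (δ / 2) := by
    rw [hμ]; simpa using half_pos hδ
  rw [Measure.hausdorffMeasure_apply] at hlt
  have h1 := lt_of_le_of_lt (le_iSup₂ (f := fun (r : ENNReal) (_ : 0 < r) =>
    ⨅ (t : ℕ → Set (Fin m → ℝ)) (_ : K ⊆ ⋃ n, t n) (_ : ∀ (n : ℕ), Metric.ediam (t n) ≤ r),
      ∑' (n : ℕ), ⨆ (_ : (t n).Nonempty), Metric.ediam (t n) ^ d) (ENNReal.ofReal (ρ / 2))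
      (by simpa using hρ)) hlt
  simp only [iInf_lt_iff] at h1
  obtain ⟨t, hKt, htd, hsum⟩ := h1
  obtain ⟨e, he0, hesum⟩ := ENNReal.exists_pos_sum_of_countable
    (ε := ENNReal.ofReal (δ / 2)) (by simpa using hδ) ℕ
  set D : ℕ → ℝ := fun n => (Metric.ediam (t n)).toReal with hD
  have hfin : ∀ n, Metric.ediam (t n) ≠ ⊤ := fun n => ((htd n).trans_lt ENNReal.ofReal_lt_top).ne
  have hDρ : ∀ n, D n ≤ ρ / 2 := fun n =>
    ENNReal.toReal_le_of_le_ofReal (by positivity) (htd n)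
  have hD0 : ∀ n, 0 ≤ D n := fun n => ENNReal.toReal_nonneg
  have hs : ∀ n, ∃ a : ℝ, 0 < a ∧ a < ρ / 2 ∧ (D n + a) ^ d ≤ D n ^ d + e n := by
    intro n
    have hc : ContinuousAt (fun a : ℝ => (D n + a) ^ d) 0 :=
      (continuousAt_const.add continuousAt_id).rpow_const (Or.inr hd.le)
    have h2 : ∀ᶠ a : ℝ in 𝓝[>] 0, (D n + a) ^ d < D n ^ d + e n := by
      refine mem_nhdsWithin_of_mem_nhds (hc.eventually (gt_mem_nhds ?_))
      simpa using he0 n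
    have h3 : ∀ᶠ a : ℝ in 𝓝[>] 0, a < ρ / 2 :=
      mem_nhdsWithin_of_mem_nhds (gt_mem_nhds (by positivity))
    obtain ⟨a, ha⟩ := (h2.and (h3.and self_mem_nhdsWithin)).exists
    exact ⟨a, ha.2.2, ha.2.1, ha.1.le⟩
  choose a ha0 haρ hae using hs
  set x : ℕ → Fin m → ℝ := fun n =>
    if h : (t n ∩ K).Nonempty then h.choose else 0 with hx
  have hxt : ∀ n, (t n ∩ K).Nonempty → x n ∈ t n ∩ K := by
    intro n hn
    simp only [hx, hn, dif_pos]
    exact hn.choose_spec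
  have hcov : K ⊆ ⋃ n : {n // (t n ∩ K).Nonempty}, ball (x n) (D n + a n) := by
    intro y hy
    obtain ⟨n, hn⟩ := Set.mem_iUnion.1 (hKt hy)
    have hne : (t n ∩ K).Nonempty := ⟨y, hn, hy⟩
    refine Set.mem_iUnion.2 ⟨⟨n, hne⟩, ?_⟩
    rw [mem_ball, dist_edist]
    have h2 : edist y (x n) ≤ Metric.ediam (t n) := Metric.edist_le_ediam_of_mem hn (hxt n hne).1
    have h3 : (edist y (x n)).toReal ≤ D n := ENNReal.toReal_mono (hfin n) h2
    have := ha0 n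
    linarith
  obtain ⟨s', hs'⟩ := hK.elim_finite_subcover _ (fun _ => isOpen_ball) hcov
  refine ⟨s'.map (Function.Embedding.subtype _), x, fun n => D n + a n, ?_, ?_, ?_⟩
  · intro n hn
    obtain ⟨⟨k, hk⟩, -, rfl⟩ := Finset.mem_map.1 hn
    have h2 := hD0 k
    have h3 := ha0 k
    have h4 := haρ k
    have h5 := hDρ k
    exact ⟨(hxt k hk).2, by change 0 < D k + a k; linarith, by change D k + a k < ρ; linarith⟩
  · intro y hy
    obtain ⟨k, hk, hyk⟩ := Set.mem_iUnion₂.1 (hs' hy)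
    exact Set.mem_iUnion₂.2 ⟨k.1, Finset.mem_map.2 ⟨k, hk, rfl⟩, hyk⟩
  · have h2 : ∑ n ∈ s'.map (Function.Embedding.subtype _), D n ^ d ≤ δ / 2 := by
      rw [← ENNReal.ofReal_le_ofReal_iff (by positivity), ENNReal.ofReal_sum_of_nonneg
        (fun n _ => Real.rpow_nonneg (hD0 n) d)]
      refine le_trans ?_ hsum.le
      refine le_trans ?_ (ENNReal.sum_le_tsum (s'.map (Function.Embedding.subtype _)))
      refine Finset.sum_le_sum fun n hn => ?_
      obtain ⟨⟨k, hk⟩, -, rfl⟩ := Finset.mem_map.1 hn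
      have hne : (t k).Nonempty := hk.mono Set.inter_subset_left
      refine le_trans ?_ (le_iSup (fun _ : (t k).Nonempty => Metric.ediam (t k) ^ d) hne)
      rw [← ENNReal.ofReal_rpow_of_nonneg (hD0 _) hd.le]
      exact le_of_eq (by simp [hD, ENNReal.ofReal_toReal (hfin k)])
    have h3 : ∑ n ∈ s'.map (Function.Embedding.subtype _), (e n : ℝ) ≤ δ / 2 := by
      rw [← ENNReal.ofReal_le_ofReal_iff (by positivity), ENNReal.ofReal_sum_of_nonneg
        (fun n _ => (e n).coe_nonneg)]
      refine le_trans ?_ hesum.le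
      refine le_trans (le_of_eq ?_) (ENNReal.sum_le_tsum (s'.map (Function.Embedding.subtype _)))
      exact Finset.sum_congr rfl fun n _ => ENNReal.ofReal_coe_nnreal
    refine (Finset.sum_le_sum fun n _ => hae n).trans ?_
    rw [Finset.sum_add_distrib]
    linarith

lemma integral_comp_inv_smul_sub {m : ℕ} (f : (Fin m → ℝ) → ℝ) (c : Fin m → ℝ) {r : ℝ}
    (hr : 0 < r) : ∫ x, f (r⁻¹ • (x - c)) = r ^ m * ∫ x, f x := by
  rw [integral_sub_right_eq_self (fun x => f (r⁻¹ • x)) c, Measure.integral_comp_inv_smul]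
  simp [abs_of_pos hr]

/-- Smooth cutoff functions vanishing near a compact set of vanishing codimension one measure,
with small total variation. -/
lemma exists_cutoff {m : ℕ} (hm : 3 ≤ m) {K V : Set (Fin m → ℝ)} (hK : IsCompact K)
    (hμ : μH[(m : ℝ) - 1] K = 0) (hV : IsClosed V) (hKV : Disjoint K V) {δ : ℝ} (hδ : 0 < δ) :
    ∃ χ g : (Fin m → ℝ) → ℝ, ContDiff ℝ 1 χ ∧ (∀ x, 0 ≤ χ x ∧ χ x ≤ 1) ∧
      (∀ x ∈ K, ∀ᶠ y in 𝓝 x, χ y = 0) ∧ (∀ x ∈ V, χ x = 1) ∧ Integrable g ∧ ∫ x, g x ≤ δ ∧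
      ∀ x, ∑ i, |fderiv ℝ χ x (Pi.single i 1)| ≤ g x := by
  have hm' : (3 : ℝ) ≤ m := by exact_mod_cast hm
  obtain ⟨ρ, hρ, hρV⟩ := hK.exists_thickening_subset_open hV.isOpen_compl
    (fun x hx hxV => Set.disjoint_left.1 hKV hx hxV)
  let β : ContDiffBump (0 : Fin m → ℝ) := ⟨1, 2, one_pos, one_lt_two⟩
  have hβc : ContDiff ℝ 1 β := β.contDiff
  set M := ∑ i : Fin m, ∫ x, |fderiv ℝ β x (Pi.single i 1)| with hM
  have hM0 : 0 ≤ M := Finset.sum_nonneg fun i _ => integral_nonneg fun x => abs_nonneg _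
  obtain ⟨s, c, r, hcr, hcov, hsum⟩ := exists_finite_ball_cover hK (d := (m : ℝ) - 1) (by linarith)
    hμ (ρ := ρ / 2) (δ := δ / (2 * (M + 1))) (by positivity) (by positivity)
  set b : ℕ → (Fin m → ℝ) → ℝ := fun n x => β ((r n)⁻¹ • (x - c n)) with hb
  set S : (Fin m → ℝ) → ℝ := fun x => ∑ n ∈ s, b n x with hS
  have hbc : ∀ n, ContDiff ℝ 1 (b n) := fun n => hβc.comp (by fun_prop)
  have hSc : ContDiff ℝ 1 S := ContDiff.sum fun n _ => hbc n
  have hb0 : ∀ n x, 0 ≤ b n x := fun n x => β.nonneg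
  have hS0 : ∀ x, 0 ≤ S x := fun x => Finset.sum_nonneg fun n _ => hb0 n x
  set η : ℝ → ℝ := fun t => (max (1 - t) 0) ^ 2 with hη
  have hη' : ∀ t, HasDerivAt η (-(2 * max (1 - t) 0)) t := fun t => by
    have h1 : HasDerivAt (fun t : ℝ => 1 - t) (-1) t := by
      simpa using (hasDerivAt_id t).const_sub 1
    have := (hasDerivAt_max_zero_sq (1 - t)).comp t h1
    rw [mul_neg_one] at this
    exact this
  have hηc : ContDiff ℝ 1 η := contDiff_max_zero_sq.comp (by fun_prop)
  have hm1 : ∀ x, max (1 - S x) 0 ≤ 1 := fun x => max_le (by linarith [hS0 x]) zero_le_one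
  have hbf : ∀ n x a, fderiv ℝ (b n) x a = (r n)⁻¹ * fderiv ℝ β ((r n)⁻¹ • (x - c n)) a := by
    intro n x a
    have h1 : HasFDerivAt (fun x => (r n)⁻¹ • (x - c n))
        ((r n)⁻¹ • ContinuousLinearMap.id ℝ (Fin m → ℝ)) x :=
      by exact ((hasFDerivAt_id x).sub_const (c n)).fun_const_smul (r n)⁻¹
    have h2 := (hβc.differentiable one_ne_zero ((r n)⁻¹ • (x - c n))).hasFDerivAt.comp x h1
    have h3 : fderiv ℝ (b n) x = _ := h2.fderiv
    rw [h3]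
    simp
  have hb_int : ∀ n ∈ s, ∀ i : Fin m, Integrable fun x => |fderiv ℝ (b n) x (Pi.single i 1)| := by
    intro n hn i
    simp only [hbf]
    have h1 := integrable_fderiv_of_hasCompactSupport hβc β.hasCompactSupport (Pi.single i 1)
    exact (((h1.comp_smul (inv_ne_zero (hcr n hn).2.1.ne')).comp_sub_right (c n)).const_mul _).abs
  refine ⟨fun x => η (S x), fun x => 2 * ∑ n ∈ s, ∑ i, |fderiv ℝ (b n) x (Pi.single i 1)|,
    hηc.comp hSc, fun x => ⟨sq_nonneg _, pow_le_one₀ (le_max_right _ _) (hm1 x)⟩, ?_, ?_, ?_, ?_, ?_⟩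
  · intro x hx
    obtain ⟨n, hn, hxn⟩ := Set.mem_iUnion₂.1 (hcov hx)
    filter_upwards [isOpen_ball.mem_nhds hxn] with y hy
    have hr := (hcr n hn).2.1
    have h1 : b n y = 1 := β.one_of_mem_closedBall (by
      rw [mem_closedBall, dist_zero_right, norm_smul, norm_inv, Real.norm_of_nonneg hr.le,
        ← dist_eq_norm]
      rw [inv_mul_le_iff₀ hr]
      exact (mem_ball.1 hy).le.trans (by simp [β]))
    have h2 : 1 ≤ S y := h1 ▸ Finset.single_le_sum (fun k _ => hb0 k y) hn
    simp only [hη]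
    rw [max_eq_right (by linarith)]
    norm_num
  · intro x hx
    have h1 : S x = 0 := by
      refine Finset.sum_eq_zero fun n hn => ?_
      obtain ⟨hcK, hr, hrρ⟩ := hcr n hn
      refine β.zero_of_le_dist ?_
      rw [dist_zero_right, norm_smul, norm_inv, Real.norm_of_nonneg hr.le, ← dist_eq_norm,
        le_inv_mul_iff₀ hr]
      change r n * 2 ≤ dist x (c n)
      by_contra! hlt
      refine hρV (mem_thickening_iff.2 ⟨c n, hcK, ?_⟩) hx
      linarith
    simp [hη, h1]
  · exact (integrable_finsetSum _ fun n hn => integrable_finsetSum _ fun i _ =>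
      hb_int n hn i).const_mul 2
  · rw [integral_const_mul, integral_finsetSum _ fun n hn => integrable_finsetSum _ fun i _ =>
      hb_int n hn i]
    have h1 : ∀ n ∈ s, ∫ x, ∑ i, |fderiv ℝ (b n) x (Pi.single i 1)| = r n ^ ((m : ℝ) - 1) * M := by
      intro n hn
      have hr := (hcr n hn).2.1
      rw [integral_finsetSum _ fun i _ => hb_int n hn i, hM, Finset.mul_sum]
      refine Finset.sum_congr rfl fun i _ => ?_
      simp only [hbf, abs_mul, abs_inv, abs_of_pos hr]
      rw [integral_const_mul, integral_comp_inv_smul_sub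
        (fun x => |fderiv ℝ β x (Pi.single i 1)|) (c n) hr, ← mul_assoc, Real.rpow_sub_one hr.ne',
        Real.rpow_natCast]
      congr 1
      field_simp
    rw [Finset.sum_congr rfl h1, ← Finset.sum_mul]
    calc 2 * ((∑ n ∈ s, r n ^ ((m : ℝ) - 1)) * M) ≤ 2 * (δ / (2 * (M + 1)) * M) := by gcongr
      _ = δ * (M / (M + 1)) := by field_simp
      _ ≤ δ * 1 := by
        gcongr
        rw [div_le_one (by positivity)]
        linarith
      _ = δ := mul_one δ
  · intro x
    have h1 : ∀ a, fderiv ℝ (fun x => η (S x)) x a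
        = -(2 * max (1 - S x) 0) * ∑ n ∈ s, fderiv ℝ (b n) x a := by
      intro a
      have h2 : HasFDerivAt S (∑ n ∈ s, fderiv ℝ (b n) x) x :=
        HasFDerivAt.fun_sum fun n _ => ((hbc n).differentiable one_ne_zero x).hasFDerivAt
      have h3 := (hη' (S x)).comp_hasFDerivAt x h2
      have h4 : fderiv ℝ (fun x => η (S x)) x = _ := h3.fderiv
      rw [h4]
      simp [_root_.sum_apply]
    change _ ≤ 2 * ∑ n ∈ s, ∑ i, |fderiv ℝ (b n) x (Pi.single i 1)|
    rw [Finset.sum_comm, Finset.mul_sum]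
    refine Finset.sum_le_sum fun i _ => ?_
    rw [h1, abs_mul, abs_neg, abs_of_nonneg (by positivity)]
    have h5 := Finset.abs_sum_le_sum_abs (fun n => fderiv ℝ (b n) x (Pi.single i 1)) s
    have h6 := hm1 x
    gcongr
    linarith

/-- The divergence of a vector field in coordinates. -/
def divg {m : ℕ} (X : (Fin m → ℝ) → (Fin m → ℝ)) (x : Fin m → ℝ) : ℝ :=
  ∑ i, fderiv ℝ X x (Pi.single i 1) i

lemma fderiv_coord {m : ℕ} {X : (Fin m → ℝ) → (Fin m → ℝ)} {x : Fin m → ℝ}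
    (hX : DifferentiableAt ℝ X x) (i : Fin m) (a : Fin m → ℝ) :
    fderiv ℝ (fun y => X y i) x a = fderiv ℝ X x a i := by
  rw [(hasFDerivAt_pi'.1 hX.hasFDerivAt i).fderiv]
  rfl

lemma continuous_divg {m : ℕ} {X : (Fin m → ℝ) → (Fin m → ℝ)} (hX : ContDiff ℝ 1 X) :
    Continuous (divg X) := by
  have := hX.continuous_fderiv one_ne_zero
  refine continuous_finsetSum _ fun i _ => ?_
  exact (continuous_apply i).comp (this.clm_apply continuous_const)

lemma divg_eq_zero_of_eventuallyEq {m : ℕ} {X : (Fin m → ℝ) → (Fin m → ℝ)} {x : Fin m → ℝ}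
    (h : ∀ᶠ y in 𝓝 x, X y = 0) : divg X x = 0 := by
  have h1 : X =ᶠ[𝓝 x] fun _ => 0 := h
  simp [divg, h1.fderiv_eq]

lemma hasCompactSupport_divg {m : ℕ} {X : (Fin m → ℝ) → (Fin m → ℝ)}
    (hc : HasCompactSupport X) : HasCompactSupport (divg X) := by
  refine HasCompactSupport.intro' hc.isCompact (isClosed_tsupport X) fun x hx => ?_
  exact divg_eq_zero_of_eventuallyEq (notMem_tsupport_iff_eventuallyEq.1 hx)

lemma integral_divg_eq_zero {m : ℕ} {X : (Fin m → ℝ) → (Fin m → ℝ)} (hX : ContDiff ℝ 1 X)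
    (hc : HasCompactSupport X) : ∫ x, divg X x = 0 := by
  have h1 : ∀ i, ContDiff ℝ 1 fun y => X y i := contDiff_pi.1 hX
  have h2 : ∀ i, HasCompactSupport fun y => X y i := fun i =>
    hc.comp_left (g := fun z : Fin m → ℝ => z i) rfl
  have h3 : ∀ x, divg X x = ∑ i, fderiv ℝ (fun y => X y i) x (Pi.single i 1) := fun x =>
    Finset.sum_congr rfl fun i _ => (fderiv_coord (hX.differentiable one_ne_zero x) i _).symm
  simp only [h3]
  rw [integral_finsetSum _ fun i _ => integrable_fderiv_of_hasCompactSupport (h1 i) (h2 i) _]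
  exact Finset.sum_eq_zero fun i _ => integral_fderiv_eq_zero_of_hasCompactSupport (h1 i) (h2 i) _

lemma divg_smul {m : ℕ} {ψ : (Fin m → ℝ) → ℝ} {X : (Fin m → ℝ) → (Fin m → ℝ)} {x : Fin m → ℝ}
    (hψ : DifferentiableAt ℝ ψ x) (hX : DifferentiableAt ℝ X x) :
    divg (fun y => ψ y • X y) x = ψ x * divg X x + coordGrad ψ x ⬝ᵥ X x := by
  have h : fderiv ℝ (fun y => ψ y • X y) x = _ := (hψ.hasFDerivAt.fun_smul hX.hasFDerivAt).fderiv
  simp only [divg, h, coordGrad, dotProduct, Finset.mul_sum, ← Finset.sum_add_distrib]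
  simp

lemma divg_sub {m : ℕ} {X Y : (Fin m → ℝ) → (Fin m → ℝ)} {x : Fin m → ℝ}
    (hX : DifferentiableAt ℝ X x) (hY : DifferentiableAt ℝ Y x) :
    divg (fun y => X y - Y y) x = divg X x - divg Y x := by
  have h : fderiv ℝ (fun y => X y - Y y) x = _ := (hX.hasFDerivAt.fun_sub hY.hasFDerivAt).fderiv
  simp [divg, h]

lemma coordGrad_mul {m : ℕ} {φ χ : (Fin m → ℝ) → ℝ} {x : Fin m → ℝ}
    (hφ : DifferentiableAt ℝ φ x) (hχ : DifferentiableAt ℝ χ x) :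
    coordGrad (fun y => φ y * χ y) x = φ x • coordGrad χ x + χ x • coordGrad φ x := by
  have h : fderiv ℝ (fun y => φ y * χ y) x = _ := (hφ.hasFDerivAt.fun_mul hχ.hasFDerivAt).fderiv
  ext i
  simp [coordGrad, h]

lemma contDiffAt_legN {m : ℕ} {F : (Fin m → ℝ) → (Fin m → ℝ)} {u : (Fin m → ℝ) → ℝ}
    {x : Fin m → ℝ} (hF : ContDiffAt ℝ 1 F x) (hu : ContDiffAt ℝ 2 u x) (h0 : gradF m F u x ≠ 0) :
    ContDiffAt ℝ 1 (legN m F u) x :=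
  (contDiffAt_euclNormalize h0 (n := 1)).comp x (contDiffAt_gradF hF hu)

lemma Hmc_eq_divg {m : ℕ} {F : (Fin m → ℝ) → (Fin m → ℝ)} {u : (Fin m → ℝ) → ℝ}
    {x : Fin m → ℝ} (hN : DifferentiableAt ℝ (legN m F u) x) :
    Hmc m F u x = divg (legN m F u) x :=
  Finset.sum_congr rfl fun i _ => by rw [pd, fderiv_coord hN, ee_eq_single]

lemma sqrt_smul_euclNormalize {m : ℕ} (g : Fin m → ℝ) :
    Real.sqrt (∑ k, g k ^ 2) • euclNormalize g = g := by
  rcases eq_or_ne g 0 with rfl | hg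
  · ext i; simp [euclNormalize]
  · have := (Real.sqrt_pos.2 (sum_sq_pos hg)).ne'
    ext i
    simp only [euclNormalize, Pi.smul_apply, smul_eq_mul]
    field_simp

lemma abs_euclNormalize_le {m : ℕ} (g : Fin m → ℝ) (i : Fin m) : |euclNormalize g i| ≤ 1 := by
  rw [euclNormalize, abs_div, abs_of_nonneg (Real.sqrt_nonneg _)]
  refine div_le_one_of_le₀ (Real.abs_le_sqrt ?_) (Real.sqrt_nonneg _)
  exact Finset.single_le_sum (f := fun k => g k ^ 2) (fun k _ => sq_nonneg _) (Finset.mem_univ i)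

lemma sub_dotProduct_euclNormalize_sub {m : ℕ} {g h : Fin m → ℝ} (hg : g ≠ 0) (hh : h ≠ 0) :
    (g - h) ⬝ᵥ (euclNormalize g - euclNormalize h) =
      (Real.sqrt (∑ k, g k ^ 2) + Real.sqrt (∑ k, h k ^ 2)) / 2 *
        ((euclNormalize g - euclNormalize h) ⬝ᵥ (euclNormalize g - euclNormalize h)) := by
  have h1 := euclNormalize_dotProduct_self hg
  have h2 := euclNormalize_dotProduct_self hh
  have h3 : euclNormalize h ⬝ᵥ euclNormalize g = euclNormalize g ⬝ᵥ euclNormalize h :=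
    dotProduct_comm _ _
  have h4 := sqrt_smul_euclNormalize g
  have h5 := sqrt_smul_euclNormalize h
  generalize euclNormalize g = n at *
  generalize euclNormalize h = l at *
  generalize Real.sqrt (∑ k, g k ^ 2) = a at *
  generalize Real.sqrt (∑ k, h k ^ 2) = b at *
  subst h4 h5
  simp only [sub_dotProduct, dotProduct_sub, smul_dotProduct, smul_eq_mul, h1, h2, h3]
  ring

lemma exists_truncation {m : ℕ} {Ω : Set (Fin m → ℝ)} (hΩ : IsOpen Ω) {w : (Fin m → ℝ) → ℝ}
    (hw : ContDiffOn ℝ 1 w Ω) {p₀ : Fin m → ℝ} {r : ℝ} (hr : closedBall p₀ r ⊆ Ω)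
    (hpos : ∀ x ∈ sphere p₀ r, 0 < w x) :
    ∃ ε > 0, ∃ (D : Set (Fin m → ℝ)) (φ : (Fin m → ℝ) → ℝ), IsCompact D ∧ D ⊆ ball p₀ r ∧
      ContDiff ℝ 1 φ ∧ (∀ x ∉ D, φ x = 0) ∧ ∀ x ∈ ball p₀ r, φ x = (max (ε - w x) 0) ^ 2 ∧
        coordGrad φ x = -(2 * max (ε - w x) 0) • coordGrad w x := by
  classical
  obtain ⟨a, ha, hle⟩ := (isCompact_sphere p₀ r).exists_forall_le'
    (hw.continuousOn.mono (sphere_subset_closedBall.trans hr)) hpos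
  set φ : (Fin m → ℝ) → ℝ := fun x => if x ∈ ball p₀ r then (max (a / 2 - w x) 0) ^ 2 else 0
  set D := closedBall p₀ r ∩ w ⁻¹' Set.Iic (a / 2)
  have hD : IsClosed D :=
    (hw.continuousOn.mono hr).preimage_isClosed_of_isClosed isClosed_closedBall isClosed_Iic
  have hDball : D ⊆ ball p₀ r := fun x hx => by
    rcases (mem_closedBall.1 hx.1).lt_or_eq with h | h
    · exact h
    · have h1 := hle x h
      have h2 : w x ≤ a / 2 := hx.2
      linarith
  have hφD : ∀ x ∉ D, φ x = 0 := fun x hx => by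
    by_cases hxb : x ∈ ball p₀ r
    · have : ¬ w x ≤ a / 2 := fun h => hx ⟨ball_subset_closedBall hxb, h⟩
      have h2 : max (a / 2 - w x) 0 = 0 := max_eq_right (by linarith)
      simp [φ, h2]
    · exact if_neg hxb
  have hφe : ∀ x ∈ ball p₀ r, φ =ᶠ[𝓝 x] fun y => (max (a / 2 - w y) 0) ^ 2 := fun x hx => by
    filter_upwards [isOpen_ball.mem_nhds hx] with y hy
    simp only [φ, if_pos hy]
  have hwa : ∀ x ∈ ball p₀ r, ContDiffAt ℝ 1 w x := fun x hx =>
    hw.contDiffAt (hΩ.mem_nhds (hr (ball_subset_closedBall hx)))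
  refine ⟨a / 2, half_pos ha, D, φ,
    (isCompact_closedBall p₀ r).of_isClosed_subset hD Set.inter_subset_left, hDball, ?_, hφD, ?_⟩
  · rw [contDiff_iff_contDiffAt]
    intro x
    by_cases hx : x ∈ D
    · exact (contDiff_max_zero_sq.contDiffAt.comp x
        (contDiffAt_const.sub (hwa x (hDball hx)))).congr_of_eventuallyEq (hφe x (hDball hx))
    · have : φ =ᶠ[𝓝 x] fun _ => 0 := by
        filter_upwards [hD.isOpen_compl.mem_nhds hx] with y hy using hφD y hy
      exact contDiffAt_const.congr_of_eventuallyEq this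
  · intro x hx
    refine ⟨(hφe x hx).eq_of_nhds, ?_⟩
    have h1 := ((hwa x hx).differentiableAt one_ne_zero).hasFDerivAt.const_sub (a / 2)
    have h2 := (hasDerivAt_max_zero_sq (a / 2 - w x)).comp_hasFDerivAt x h1
    have h3 : fderiv ℝ (fun y => (max (a / 2 - w y) 0) ^ 2) x = _ := h2.fderiv
    ext i
    simp [coordGrad, (hφe x hx).fderiv_eq, h3]

lemma sub_dotProduct_euclNormalize_sub_nonneg {m : ℕ} {g h : Fin m → ℝ} (hg : g ≠ 0) (hh : h ≠ 0) :
    0 ≤ (g - h) ⬝ᵥ (euclNormalize g - euclNormalize h) := by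
  rw [sub_dotProduct_euclNormalize_sub hg hh]
  exact mul_nonneg (by positivity) (Finset.sum_nonneg fun i _ => mul_self_nonneg _)

lemma sub_dotProduct_euclNormalize_sub_pos {m : ℕ} {g h : Fin m → ℝ} (hg : g ≠ 0) (hh : h ≠ 0)
    (hne : euclNormalize g ≠ euclNormalize h) :
    0 < (g - h) ⬝ᵥ (euclNormalize g - euclNormalize h) := by
  rw [sub_dotProduct_euclNormalize_sub hg hh]
  have h1 := Real.sqrt_pos.2 (sum_sq_pos hg)
  refine mul_pos (by positivity) ?_
  refine (sum_sq_pos (sub_ne_zero.2 hne)).trans_le (le_of_eq ?_)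
  exact Finset.sum_congr rfl fun i _ => sq _

lemma coordGrad_sub_eq_gradF_sub {m : ℕ} {F : (Fin m → ℝ) → (Fin m → ℝ)} {u v : (Fin m → ℝ) → ℝ}
    {x : Fin m → ℝ} (hu : ContDiffAt ℝ 2 u x) (hv : ContDiffAt ℝ 2 v x) :
    coordGrad (fun y => v y - u y) x = gradF m F v x - gradF m F u x := by
  rw [coordGrad_sub (hu.differentiableAt two_ne_zero) (hv.differentiableAt two_ne_zero),
    gradF_eq, gradF_eq]
  exact (add_sub_add_right_eq_sub _ _ _).symm

/-- Lower bound for the divergence of the truncated difference of the normals. -/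
lemma le_divg_smul_legN_sub {m : ℕ} {F : (Fin m → ℝ) → (Fin m → ℝ)} {u v φ χ : (Fin m → ℝ) → ℝ}
    {x : Fin m → ℝ} (hF : ContDiffAt ℝ 1 F x) (hu : ContDiffAt ℝ 2 u x) (hv : ContDiffAt ℝ 2 v x)
    (hgu : gradF m F u x ≠ 0) (hgv : gradF m F v x ≠ 0) (hH : Hmc m F v x ≤ Hmc m F u x)
    (hφ : DifferentiableAt ℝ φ x) (hχ : DifferentiableAt ℝ χ x) (hφ0 : 0 ≤ φ x) (hχ0 : 0 ≤ χ x)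
    {t B : ℝ} (hφB : φ x ≤ B)
    (hgrad : coordGrad φ x = -(2 * t) • coordGrad (fun y => v y - u y) x) :
    χ x * (2 * t * ((gradF m F u x - gradF m F v x) ⬝ᵥ (legN m F u x - legN m F v x)))
        - 2 * B * ∑ i, |fderiv ℝ χ x (Pi.single i 1)| ≤
      divg (fun y => (φ y * χ y) • (legN m F u y - legN m F v y)) x := by
  have hNu := (contDiffAt_legN hF hu hgu).differentiableAt one_ne_zero
  have hNv := (contDiffAt_legN hF hv hgv).differentiableAt one_ne_zero
  rw [divg_smul (hφ.fun_mul hχ) (hNu.fun_sub hNv), divg_sub hNu hNv, ← Hmc_eq_divg hNu, ← Hmc_eq_divg hNv,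
    coordGrad_mul hφ hχ, hgrad, coordGrad_sub_eq_gradF_sub hu hv (F := F)]
  have h1 : -(∑ i, |fderiv ℝ χ x (Pi.single i 1)|) * 2 ≤
      coordGrad χ x ⬝ᵥ (legN m F u x - legN m F v x) := by
    rw [neg_mul, Finset.sum_mul, ← Finset.sum_neg_distrib]
    refine Finset.sum_le_sum fun i _ => ?_
    have h2 : |legN m F u x i - legN m F v x i| ≤ 2 := by
      have h3 := abs_euclNormalize_le (gradF m F u x) i
      have h4 := abs_euclNormalize_le (gradF m F v x) i
      refine (abs_sub _ _).trans ?_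
      rw [legN_eq, legN_eq]
      linarith
    refine neg_le_of_abs_le ?_
    rw [abs_mul]
    exact mul_le_mul_of_nonneg_left h2 (abs_nonneg _)
  have hs : 0 ≤ ∑ i, |fderiv ℝ χ x (Pi.single i 1)| := Finset.sum_nonneg fun i _ => abs_nonneg _
  have h5 : 0 ≤ φ x * χ x * (Hmc m F u x - Hmc m F v x) :=
    mul_nonneg (mul_nonneg hφ0 hχ0) (sub_nonneg.2 hH)
  have h6 := mul_le_mul_of_nonneg_left h1 hφ0
  have h7 := mul_le_mul_of_nonneg_right hφB hs
  rw [← neg_sub (gradF m F u x)]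
  simp only [add_dotProduct, smul_dotProduct, smul_eq_mul, neg_dotProduct] at *
  linarith

/-- Where the truncation of `v - u` lives, the normals of `u` and `v` agree off the singular set
of `v`. -/
lemma legN_eq_of_truncation {m : ℕ} (hm : 3 ≤ m) {Ω : Set (Fin m → ℝ)} (hΩ : IsOpen Ω)
    {F : (Fin m → ℝ) → (Fin m → ℝ)} (hF : ContDiffOn ℝ 1 F Ω) {u v : (Fin m → ℝ) → ℝ}
    (hu : ContDiffOn ℝ 2 u Ω) (hv : ContDiffOn ℝ 2 v Ω) (hvu : ∀ x ∈ Ω, u x ≤ v x)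
    (hS : ∀ x ∈ Ω, gradF m F u x = 0 → gradF m F v x = 0)
    (hμ : μH[(m : ℝ) - 1] (SingSet m Ω F v) = 0)
    (hH : ∀ x ∈ Ω, gradF m F v x ≠ 0 → Hmc m F v x ≤ Hmc m F u x)
    {p₀ : Fin m → ℝ} {r ε : ℝ} (hr : ball p₀ r ⊆ Ω) {D : Set (Fin m → ℝ)}
    (hD : IsCompact D) (hDr : D ⊆ ball p₀ r) {φ : (Fin m → ℝ) → ℝ} (hφ : ContDiff ℝ 1 φ)
    (hφD : ∀ x ∉ D, φ x = 0)
    (hφr : ∀ x ∈ ball p₀ r, φ x = (max (ε - (v x - u x)) 0) ^ 2 ∧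
      coordGrad φ x = -(2 * max (ε - (v x - u x)) 0) • coordGrad (fun y => v y - u y) x)
    {q : Fin m → ℝ} (hq : q ∈ ball p₀ r) (hqε : v q - u q < ε) (hgq : gradF m F v q ≠ 0) :
    legN m F u q = legN m F v q := by
  by_contra hne
  have hFa : ∀ x ∈ Ω, ContDiffAt ℝ 1 F x := fun x hx => hF.contDiffAt (hΩ.mem_nhds hx)
  have hua : ∀ x ∈ Ω, ContDiffAt ℝ 2 u x := fun x hx => hu.contDiffAt (hΩ.mem_nhds hx)
  have hva : ∀ x ∈ Ω, ContDiffAt ℝ 2 v x := fun x hx => hv.contDiffAt (hΩ.mem_nhds hx)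
  have hDΩ : D ⊆ Ω := hDr.trans hr
  have hqΩ := hr hq
  have hgne : ∀ x ∈ Ω, gradF m F v x ≠ 0 → gradF m F u x ≠ 0 := fun x hx h h' => h (hS x hx h')
  set K := D ∩ gradF m F v ⁻¹' {0} with hKdef
  have hgvc : ContinuousOn (gradF m F v) Ω := fun x hx =>
    (contDiffAt_gradF (hFa x hx) (hva x hx)).continuousAt.continuousWithinAt
  have hK : IsCompact K := hD.of_isClosed_subset
    ((hgvc.mono hDΩ).preimage_isClosed_of_isClosed hD.isClosed isClosed_singleton)
    Set.inter_subset_left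
  have hKμ : μH[(m : ℝ) - 1] K = 0 := measure_mono_null
    (show K ⊆ SingSet m Ω F v from fun x hx => ⟨hDΩ hx.1, hx.2⟩) hμ
  set P : (Fin m → ℝ) → ℝ := fun x => 2 * max (ε - (v x - u x)) 0 *
    ((gradF m F u x - gradF m F v x) ⬝ᵥ (legN m F u x - legN m F v x)) with hP
  have hPq : 0 < P q := by
    have h1 := sub_dotProduct_euclNormalize_sub_pos (hgne q hqΩ hgq) hgq hne
    have h2 : 0 < max (ε - (v q - u q)) 0 := lt_max_of_lt_left (by linarith)
    exact mul_pos (by positivity) h1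
  have hP0 : ∀ x ∈ Ω, gradF m F v x ≠ 0 → 0 ≤ P x := fun x hx h =>
    mul_nonneg (by positivity) (sub_dotProduct_euclNormalize_sub_nonneg (hgne x hx h) h)
  have hPc : ContinuousAt P q := by
    have h1 := (contDiffAt_gradF (hFa q hqΩ) (hua q hqΩ)).continuousAt
    have h2 := (contDiffAt_gradF (hFa q hqΩ) (hva q hqΩ)).continuousAt
    have h3 := (contDiffAt_legN (hFa q hqΩ) (hua q hqΩ) (hgne q hqΩ hgq)).continuousAt
    have h4 := (contDiffAt_legN (hFa q hqΩ) (hva q hqΩ) hgq).continuousAt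
    have h5 := (hua q hqΩ).continuousAt
    have h6 := (hva q hqΩ).continuousAt
    have h7 : Continuous fun p : (Fin m → ℝ) × (Fin m → ℝ) => p.1 ⬝ᵥ p.2 := by fun_prop
    have h8 : ContinuousAt (fun x => (gradF m F u x - gradF m F v x) ⬝ᵥ
      (legN m F u x - legN m F v x)) q := h7.continuousAt.comp ((h1.sub h2).prodMk (h3.sub h4))
    exact (continuousAt_const.mul ((continuousAt_const.sub (h6.sub h5)).max continuousAt_const)).mul
      h8
  set κ := P q / 2 with hκ
  have hκ0 : 0 < κ := half_pos hPq
  have hnhds : ∀ᶠ x in 𝓝 q, κ < P x ∧ x ∈ ball p₀ r ∧ gradF m F v x ≠ 0 ∧ v x - u x < ε := by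
    filter_upwards [hPc.eventually_const_lt (half_lt_self hPq), isOpen_ball.mem_nhds hq,
      (contDiffAt_gradF (hFa q hqΩ) (hva q hqΩ)).continuousAt.eventually_ne hgq,
      ((hva q hqΩ).continuousAt.sub (hua q hqΩ).continuousAt).eventually_lt_const hqε]
      with x h1 h2 h3 h4 using ⟨h1, h2, h3, h4⟩
  obtain ⟨ρ, hρ, hρV⟩ := nhds_basis_closedBall.mem_iff.1 hnhds
  set V := closedBall q ρ
  have hVK : Disjoint K V := Set.disjoint_left.2 fun x hx hxV => (hρV hxV).2.2.1 hx.2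
  have hVD : V ⊆ D := fun x hx => by
    by_contra hxD
    obtain ⟨-, h1, -, h2⟩ := hρV hx
    have h3 := hφD x hxD
    rw [(hφr x h1).1, max_eq_left (by linarith)] at h3
    have := pow_eq_zero_iff two_ne_zero |>.1 h3
    linarith
  have hVpos : 0 < volume.real V :=
    ENNReal.toReal_pos (measure_closedBall_pos volume q hρ).ne' measure_closedBall_lt_top.ne
  have hε : 0 < ε := (sub_nonneg.2 (hvu q hqΩ)).trans_lt hqε
  obtain ⟨χ, g, hχ, hχ01, hχK, hχV, hg, hgδ, hχg⟩ := exists_cutoff hm hK hKμ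
    isClosed_closedBall hVK (δ := κ * volume.real V / (4 * ε ^ 2)) (by positivity)
  set T : (Fin m → ℝ) → (Fin m → ℝ) :=
    fun y => (φ y * χ y) • (legN m F u y - legN m F v y) with hT
  have hTD : ∀ x ∉ D, ∀ᶠ y in 𝓝 x, T y = 0 := fun x hx => by
    filter_upwards [hD.isClosed.isOpen_compl.mem_nhds hx] with y hy
    simp [hT, hφD y hy]
  have hTK : ∀ x ∈ K, ∀ᶠ y in 𝓝 x, T y = 0 := fun x hx => by
    filter_upwards [hχK x hx] with y hy
    simp [hT, hy]
  have hTc : HasCompactSupport T := HasCompactSupport.intro' hD hD.isClosed fun x hx =>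
    (hTD x hx).self_of_nhds
  have hzero : ∀ x, (∀ᶠ y in 𝓝 x, T y = 0) → ContDiffAt ℝ 1 T x := fun x h =>
    contDiffAt_const.congr_of_eventuallyEq (f := fun _ => (0 : Fin m → ℝ)) h
  have hTd : ContDiff ℝ 1 T := by
    rw [contDiff_iff_contDiffAt]
    intro x
    by_cases hx : x ∈ D
    · by_cases hxK : gradF m F v x = 0
      · exact hzero x (hTK x ⟨hx, hxK⟩)
      · have hxΩ := hDΩ hx
        exact (hφ.contDiffAt.mul hχ.contDiffAt).smul
          ((contDiffAt_legN (hFa x hxΩ) (hua x hxΩ) (hgne x hxΩ hxK)).sub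
            (contDiffAt_legN (hFa x hxΩ) (hva x hxΩ) hxK))
    · exact hzero x (hTD x hx)
  have hg0 : ∀ x, 0 ≤ g x := fun x =>
    (Finset.sum_nonneg fun i _ => abs_nonneg _).trans (hχg x)
  have hlow : ∀ x, V.indicator (fun _ => κ) x - 2 * ε ^ 2 * g x ≤ divg T x := by
    intro x
    have hε2 : 0 ≤ 2 * ε ^ 2 := by positivity
    have hzero' : x ∉ V → (∀ᶠ y in 𝓝 x, T y = 0) →
        V.indicator (fun _ => κ) x - 2 * ε ^ 2 * g x ≤ divg T x := fun hxV h => by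
      rw [Set.indicator_of_notMem hxV, divg_eq_zero_of_eventuallyEq h, zero_sub]
      exact neg_nonpos.2 (mul_nonneg hε2 (hg0 x))
    by_cases hx : x ∈ D
    · by_cases hxK : gradF m F v x = 0
      · exact hzero' (fun h => Set.disjoint_left.1 hVK ⟨hx, hxK⟩ h) (hTK x ⟨hx, hxK⟩)
      · have hxΩ := hDΩ hx
        have hw0 := hvu x hxΩ
        have hφB : φ x ≤ ε ^ 2 := by
          rw [(hφr x (hDr hx)).1]
          exact pow_le_pow_left₀ (le_max_right _ _) (max_le (by linarith) hε.le) 2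
        have h1 := le_divg_smul_legN_sub (hFa x hxΩ) (hua x hxΩ) (hva x hxΩ) (hgne x hxΩ hxK) hxK
          (hH x hxΩ hxK) (hφ.differentiable one_ne_zero x) (hχ.differentiable one_ne_zero x)
          (by rw [(hφr x (hDr hx)).1]; positivity) (hχ01 x).1 hφB (hφr x (hDr hx)).2
        refine le_trans ?_ h1
        refine sub_le_sub ?_ (mul_le_mul_of_nonneg_left (hχg x) hε2)
        change _ ≤ χ x * P x
        by_cases hxV : x ∈ V
        · rw [Set.indicator_of_mem hxV, hχV x hxV, one_mul]
          exact (hρV hxV).1.le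
        · rw [Set.indicator_of_notMem hxV]
          exact mul_nonneg (hχ01 x).1 (hP0 x hxΩ hxK)
    · exact hzero' (fun h => hx (hVD h)) (hTD x hx)
  have hVint : Integrable (V.indicator fun _ => κ) :=
    (integrable_indicator_iff measurableSet_closedBall).2
      (integrableOn_const measure_closedBall_lt_top.ne)
  have hmono := integral_mono (hVint.sub (hg.const_mul (2 * ε ^ 2)))
    ((continuous_divg hTd).integrable_of_hasCompactSupport (hasCompactSupport_divg hTc)) hlow
  rw [integral_divg_eq_zero hTd hTc, integral_sub' hVint (hg.const_mul _), integral_const_mul,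
    integral_indicator measurableSet_closedBall, setIntegral_const, smul_eq_mul] at hmono
  have h2 := mul_le_mul_of_nonneg_left hgδ (by positivity : 0 ≤ 2 * ε ^ 2)
  have h3 : 2 * ε ^ 2 * (κ * volume.real V / (4 * ε ^ 2)) = κ * volume.real V / 2 := by
    field_simp; norm_num
  have h4 : 0 < κ * volume.real V := by positivity
  linarith

lemma dotProduct_mulVec_self_of_antisymm {m : ℕ} {A : Matrix (Fin m) (Fin m) ℝ}
    (hA : ∀ j k, A j k + A k j = 0) (n : Fin m → ℝ) : n ⬝ᵥ A.mulVec n = 0 := by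
  have h1 : A.transpose = -A := Matrix.ext fun i j => by
    simpa using eq_neg_of_add_eq_zero_left (hA j i)
  have h2 : n ⬝ᵥ A.mulVec n = -(n ⬝ᵥ A.mulVec n) := by
    conv_lhs => rw [Matrix.dotProduct_mulVec, ← Matrix.mulVec_transpose, h1, Matrix.neg_mulVec,
      neg_dotProduct, dotProduct_comm]
  linarith

lemma divg_mulVec_gradF {m : ℕ} {A : Matrix (Fin m) (Fin m) ℝ} (hA : ∀ j k, A j k + A k j = 0)
    {F : (Fin m → ℝ) → (Fin m → ℝ)} {u : (Fin m → ℝ) → ℝ} {x : Fin m → ℝ}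
    (hF : ContDiffAt ℝ 1 F x) (hu : ContDiffAt ℝ 2 u x) :
    divg (fun y => A.mulVec (gradF m F u y)) x = divFb m A F x := by
  have hFd := hF.differentiableAt one_ne_zero
  have hud := (contDiffAt_coordGrad hu).differentiableAt one_ne_zero
  have hlin : ∀ {X : (Fin m → ℝ) → (Fin m → ℝ)}, DifferentiableAt ℝ X x →
      HasFDerivAt (fun y => A.mulVec (X y))
        ((Matrix.mulVecLin A).toContinuousLinearMap.comp (fderiv ℝ X x)) x := fun hX =>
    (Matrix.mulVecLin A).toContinuousLinearMap.hasFDerivAt.comp x hX.hasFDerivAt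
  have h1 : divFb m A F x = divg (fun y => A.mulVec (F y)) x := by
    refine Finset.sum_congr rfl fun i _ => ?_
    rw [← fderiv_coord (hlin hFd).differentiableAt, pd, ee_eq_single]
    rfl
  have h2 : divg (fun y => A.mulVec (coordGrad u y)) x = 0 := by
    have hsym := hu.isSymmSndFDerivAt (by simp)
    have h3 : divg (fun y => A.mulVec (coordGrad u y)) x = ∑ j, ∑ k, A j k *
        fderiv ℝ (fderiv ℝ u) x (Pi.single j 1) (Pi.single k 1) := by
      simp only [divg, (hlin hud).fderiv]
      refine Finset.sum_congr rfl fun j _ => ?_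
      change ∑ k, A j k * fderiv ℝ (coordGrad u) x (Pi.single j 1) k = _
      exact Finset.sum_congr rfl fun k _ => by rw [fderiv_coordGrad_apply hu]
    have h4 : divg (fun y => A.mulVec (coordGrad u y)) x
        = -divg (fun y => A.mulVec (coordGrad u y)) x := by
      conv_lhs => rw [h3, Finset.sum_comm]
      rw [h3, ← Finset.sum_neg_distrib]
      refine Finset.sum_congr rfl fun j _ => ?_
      rw [← Finset.sum_neg_distrib]
      refine Finset.sum_congr rfl fun k _ => ?_
      rw [hsym.eq (Pi.single k 1) (Pi.single j 1), eq_neg_of_add_eq_zero_left (hA k j), neg_mul]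
    linarith
  have h5 : (fun y => A.mulVec (gradF m F u y))
      = fun y => A.mulVec (F y) - A.mulVec (-coordGrad u y) := by
    rw [gradF_eq]
    funext y
    rw [← Matrix.mulVec_sub, sub_neg_eq_add, add_comm]
  have h6 : divg (fun y => A.mulVec (-coordGrad u y)) x = 0 := by
    have h7 := hlin hud
    have h8 : fderiv ℝ (fun y => A.mulVec (-coordGrad u y)) x =
        -fderiv ℝ (fun y => A.mulVec (coordGrad u y)) x := by
      simp only [Matrix.mulVec_neg]
      exact h7.fun_neg.fderiv.trans (congrArg Neg.neg h7.fderiv.symm)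
    simp only [divg, h8] at h2 ⊢
    simpa using h2
  rw [h5, divg_sub (hlin hFd).differentiableAt, h6, sub_zero, h1]
  exact (hlin hud.fun_neg).differentiableAt

/-- A touching point which is singular for both functions cannot be strictly separated by a
sphere. -/
lemma not_forall_sphere_lt {m : ℕ} (hm : 3 ≤ m) {Ω : Set (Fin m → ℝ)} (hΩ : IsOpen Ω)
    {F : (Fin m → ℝ) → (Fin m → ℝ)} (hF : ContDiffOn ℝ 1 F Ω) {u v : (Fin m → ℝ) → ℝ}
    (hu : ContDiffOn ℝ 2 u Ω) (hv : ContDiffOn ℝ 2 v Ω) (hvu : ∀ x ∈ Ω, u x ≤ v x)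
    (hS : ∀ x ∈ Ω, gradF m F u x = 0 → gradF m F v x = 0)
    (hμ : μH[(m : ℝ) - 1] (SingSet m Ω F v) = 0)
    (hH : ∀ x ∈ Ω, gradF m F v x ≠ 0 → Hmc m F v x ≤ Hmc m F u x)
    {A : Matrix (Fin m) (Fin m) ℝ} (hA : ∀ j k, A j k + A k j = 0)
    (hdiv : ∀ x ∈ Ω, 0 < divFb m A F x) {p₀ : Fin m → ℝ} (htouch : v p₀ = u p₀)
    {r : ℝ} (hr0 : 0 < r) (hr : closedBall p₀ r ⊆ Ω) :
    ¬ ∀ x ∈ sphere p₀ r, u x < v x := by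
  intro hsph
  obtain ⟨ε, hε, D, φ, hD, hDr, hφ, hφD, hφr⟩ := exists_truncation hΩ
    (w := fun y => v y - u y) ((hv.sub hu).of_le one_le_two) hr fun x hx => sub_pos.2 (hsph x hx)
  have hrΩ := ball_subset_closedBall.trans hr
  have hFa : ∀ x ∈ Ω, ContDiffAt ℝ 1 F x := fun x hx => hF.contDiffAt (hΩ.mem_nhds hx)
  have hua : ∀ x ∈ Ω, ContDiffAt ℝ 2 u x := fun x hx => hu.contDiffAt (hΩ.mem_nhds hx)
  have hva : ∀ x ∈ Ω, ContDiffAt ℝ 2 v x := fun x hx => hv.contDiffAt (hΩ.mem_nhds hx)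
  have hDΩ : D ⊆ Ω := hDr.trans hrΩ
  have horth : ∀ x ∈ ball p₀ r, v x - u x < ε →
      coordGrad (fun y => v y - u y) x ⬝ᵥ A.mulVec (gradF m F u x) = 0 := by
    intro x hx hxε
    have hxΩ := hrΩ hx
    rw [coordGrad_sub_eq_gradF_sub (hua x hxΩ) (hva x hxΩ) (F := F)]
    have hself := dotProduct_mulVec_self_of_antisymm hA
    by_cases hg : gradF m F v x = 0
    · rw [hg, zero_sub, neg_dotProduct, hself, neg_zero]
    · have hN := legN_eq_of_truncation hm hΩ hF hu hv hvu hS hμ hH hrΩ hD hDr hφ hφD hφr hx hxε hg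
      rw [legN_eq, legN_eq] at hN
      have h1 := sqrt_smul_euclNormalize (gradF m F u x)
      have h2 := sqrt_smul_euclNormalize (gradF m F v x)
      rw [← hN] at h2
      rw [sub_dotProduct, hself, sub_zero, ← h2]
      conv_lhs => rw [smul_dotProduct]; enter [2, 2]; rw [← h1]
      rw [Matrix.mulVec_smul, dotProduct_smul, hself, smul_zero, smul_zero]
  set T : (Fin m → ℝ) → (Fin m → ℝ) := fun y => φ y • A.mulVec (gradF m F u y) with hT
  have hTD : ∀ x ∉ D, ∀ᶠ y in 𝓝 x, T y = 0 := fun x hx => by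
    filter_upwards [hD.isClosed.isOpen_compl.mem_nhds hx] with y hy
    simp [hT, hφD y hy]
  have hTc : HasCompactSupport T := HasCompactSupport.intro' hD hD.isClosed fun x hx =>
    (hTD x hx).self_of_nhds
  have hAG : ∀ x ∈ Ω, ContDiffAt ℝ 1 (fun y => A.mulVec (gradF m F u y)) x := fun x hx =>
    (Matrix.mulVecLin A).toContinuousLinearMap.contDiff.contDiffAt.comp x
      (contDiffAt_gradF (hFa x hx) (hua x hx))
  have hTd : ContDiff ℝ 1 T := by
    rw [contDiff_iff_contDiffAt]
    intro x
    by_cases hx : x ∈ D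
    · exact hφ.contDiffAt.smul (hAG x (hDΩ hx))
    · exact contDiffAt_const.congr_of_eventuallyEq (f := fun _ => (0 : Fin m → ℝ)) (hTD x hx)
  have hdivT : ∀ x ∈ ball p₀ r, divg T x = φ x * divFb m A F x := by
    intro x hx
    have hxΩ := hrΩ hx
    rw [hT, divg_smul (hφ.differentiable one_ne_zero x)
      ((hAG x hxΩ).differentiableAt one_ne_zero), divg_mulVec_gradF hA (hFa x hxΩ) (hua x hxΩ),
      (hφr x hx).2, smul_dotProduct]
    rcases lt_or_ge (v x - u x) ε with h | h
    · rw [horth x hx h, smul_zero, add_zero]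
    · rw [max_eq_right (by linarith)]
      simp
  have hpos := (continuous_divg hTd).integral_pos_of_hasCompactSupport_nonneg_nonzero (μ := volume)
    (x := p₀) (hasCompactSupport_divg hTc) (fun x => ?_) ?_
  · exact hpos.ne' (integral_divg_eq_zero hTd hTc)
  · by_cases hx : x ∈ D
    · rw [hdivT x (hDr hx), (hφr x (hDr hx)).1]
      exact mul_nonneg (sq_nonneg _) (hdiv x (hDΩ hx)).le
    · exact (divg_eq_zero_of_eventuallyEq (hTD x hx)).ge
  · have h0 := mem_ball_self (x := p₀) hr0
    rw [hdivT p₀ h0, (hφr p₀ h0).1, htouch, sub_self, sub_zero, max_eq_left hε.le]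
    exact (mul_pos (by positivity) (hdiv p₀ (hrΩ h0))).ne'

lemma divFb_neg_left {m : ℕ} (A : Matrix (Fin m) (Fin m) ℝ) (F : (Fin m → ℝ) → (Fin m → ℝ))
    (x : Fin m → ℝ) : divFb m (-A) F x = -divFb m A F x := by
  simp only [divFb, pd, Matrix.neg_apply, neg_mul, Finset.sum_neg_distrib, fderiv_fun_neg,
    _root_.neg_apply]

lemma divFb_neg_right {m : ℕ} (A : Matrix (Fin m) (Fin m) ℝ) (F : (Fin m → ℝ) → (Fin m → ℝ))
    (x : Fin m → ℝ) : divFb m A (-F) x = -divFb m A F x := by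
  simp only [divFb, pd, Pi.neg_apply, mul_neg, Finset.sum_neg_distrib, fderiv_fun_neg,
    _root_.neg_apply]

lemma gradF_neg {m : ℕ} (F : (Fin m → ℝ) → (Fin m → ℝ)) (u : (Fin m → ℝ) → ℝ) :
    gradF m (-F) (-u) = -gradF m F u := by
  ext x i
  simp [gradF, pd, fderiv_neg, add_comm]

lemma legN_neg {m : ℕ} (F : (Fin m → ℝ) → (Fin m → ℝ)) (u : (Fin m → ℝ) → ℝ) :
    legN m (-F) (-u) = -legN m F u := by
  ext x i
  simp [legN, gradF_neg, neg_div]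

lemma Hmc_neg {m : ℕ} (F : (Fin m → ℝ) → (Fin m → ℝ)) (u : (Fin m → ℝ) → ℝ) (x : Fin m → ℝ) :
    Hmc m (-F) (-u) x = -Hmc m F u x := by
  simp only [Hmc, pd, legN_neg, Pi.neg_apply, fderiv_fun_neg, _root_.neg_apply,
    Finset.sum_neg_distrib]

lemma SingSet_neg {m : ℕ} (Ω : Set (Fin m → ℝ)) (F : (Fin m → ℝ) → (Fin m → ℝ))
    (u : (Fin m → ℝ) → ℝ) : SingSet m Ω (-F) (-u) = SingSet m Ω F u := by
  simp [SingSet, gradF_neg]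

lemma GoodFrame.neg {m : ℕ} {U : Set (Fin m → ℝ)} {F : (Fin m → ℝ) → (Fin m → ℝ)}
    {u : (Fin m → ℝ) → ℝ} (h : GoodFrame m U F u) : GoodFrame m U (-F) (-u) := by
  obtain ⟨Nw, h1, h2, h3, h4⟩ := h
  refine ⟨Nw, h1, h2, fun x hx α => ?_, h4⟩
  simp [legN_neg, h3 x hx α]

lemma eqOn_of_isolated_singular_point {m : ℕ} (hm : 3 ≤ m) {Ω : Set (Fin m → ℝ)} (hΩ : IsOpen Ω)
    (hΩc : IsConnected Ω) {F : (Fin m → ℝ) → (Fin m → ℝ)} (hF : ContDiffOn ℝ 1 F Ω)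
    {u v : (Fin m → ℝ) → ℝ} (hu : ContDiffOn ℝ 2 u Ω) (hv : ContDiffOn ℝ 2 v Ω)
    (hvu : ∀ x ∈ Ω, u x ≤ v x) {p₀ : Fin m → ℝ} (hp₀ : p₀ ∈ Ω) (htouch : v p₀ = u p₀)
    {A : Matrix (Fin m) (Fin m) ℝ} (hA : ∀ j k, A j k + A k j = 0)
    (hdiv : (∀ x ∈ Ω, 0 < divFb m A F x) ∨ (∀ x ∈ Ω, divFb m A F x < 0))
    (hS : SingSet m Ω F u = {p₀})
    (hμ : μH[(m : ℝ) - 1] (closure (SingSet m Ω F v)) = 0)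
    (hH : ∀ x ∈ Ω \ ({p₀} ∪ SingSet m Ω F v), Hmc m F v x ≤ Hmc m F u x)
    (hframe : ∀ p ∈ Ω \ {p₀}, ∃ U : Set (Fin m → ℝ), IsOpen U ∧ p ∈ U ∧ U ⊆ Ω ∧
      GoodFrame m U F u) :
    ∀ x ∈ Ω, v x = u x := by
  have hp₀v : gradF m F v p₀ = 0 := by
    have h1 : p₀ ∈ SingSet m Ω F u := hS ▸ Set.mem_singleton p₀
    rw [gradF_eq_of_touch hΩ hu hv hvu hp₀ htouch]
    exact h1.2
  have hS' : ∀ x ∈ Ω, gradF m F u x = 0 → gradF m F v x = 0 := fun x hx h => by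
    have h1 : x ∈ SingSet m Ω F u := ⟨hx, h⟩
    rw [hS, Set.mem_singleton_iff] at h1
    rwa [h1]
  have hH' : ∀ x ∈ Ω, gradF m F v x ≠ 0 → Hmc m F v x ≤ Hmc m F u x := fun x hx h => by
    refine hH x ⟨hx, ?_⟩
    rintro (h1 | h1)
    · rw [Set.mem_singleton_iff.1 h1] at h
      exact h hp₀v
    · exact h h1.2
  have hμ' := measure_mono_null subset_closure hμ
  refine eqOn_of_coincidence_isOpen hm hΩ hΩc hu hv hvu hp₀ htouch (fun p hp hpp hpt => ?_)
    fun r hr0 hr => ?_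
  · obtain ⟨U, hU, hpU, hUΩ, hfr⟩ := hframe p ⟨hp, hpp⟩
    exact coincidence_mem_nhds hΩ hF hu hv hvu hS hH ⟨hp, hpp⟩ hU hpU hUΩ hfr hpt
  · rcases hdiv with hdiv | hdiv
    · exact not_forall_sphere_lt hm hΩ hF hu hv hvu hS' hμ' hH' hA hdiv htouch hr0 hr
    · refine not_forall_sphere_lt hm hΩ hF hu hv hvu hS' hμ' hH' (A := -A) (fun j k => ?_)
        (fun x hx => ?_) htouch hr0 hr
      · have := hA j k
        simp only [Matrix.neg_apply]
        linarith
      · rw [divFb_neg_left]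
        exact neg_pos.2 (hdiv x hx)

end

/-- Theorem J: strong maximum principle for `H_F` when the
touching point `p₀` is an isolated singular point of one of the two comparison
functions (either of `u` — the main version — or of `v` — the version with the
roles of `u` and `v` interchanged). -/
theorem strong_max_principle_isolated_singular_point
    (m : ℕ) (hm : 3 ≤ m)
    (Ω : Set (Fin m → ℝ)) (hΩopen : IsOpen Ω) (hΩconn : IsConnected Ω)
    (F : (Fin m → ℝ) → (Fin m → ℝ)) (hF : ContDiffOn ℝ 1 F Ω)
    (u v : (Fin m → ℝ) → ℝ)
    (hu : ContDiffOn ℝ 2 u Ω) (hv : ContDiffOn ℝ 2 v Ω)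
    (hvu : ∀ x ∈ Ω, u x ≤ v x)
    (p₀ : Fin m → ℝ) (hp₀ : p₀ ∈ Ω) (htouch : v p₀ = u p₀)
    (A : Matrix (Fin m) (Fin m) ℝ) (hA : ∀ j k, A j k + A k j = 0)
    (hdiv : (∀ x ∈ Ω, 0 < divFb m A F x) ∨ (∀ x ∈ Ω, divFb m A F x < 0))
    (hmain :
      -- main version: `p₀` is the only singular point of `u`
      (SingSet m Ω F u = {p₀} ∧
       μH[(m : ℝ) - 1] (closure (SingSet m Ω F v)) = 0 ∧
       (∀ x ∈ Ω \ ({p₀} ∪ SingSet m Ω F v), Hmc m F v x ≤ Hmc m F u x) ∧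
       (∀ p ∈ Ω \ {p₀}, ∃ U : Set (Fin m → ℝ), IsOpen U ∧ p ∈ U ∧ U ⊆ Ω ∧
         GoodFrame m U F u))
      ∨
      -- interchanged version: `p₀` is the only singular point of `v`
      (SingSet m Ω F v = {p₀} ∧
       μH[(m : ℝ) - 1] (closure (SingSet m Ω F u)) = 0 ∧
       (∀ x ∈ Ω \ ({p₀} ∪ SingSet m Ω F u), Hmc m F v x ≤ Hmc m F u x) ∧
       (∀ p ∈ Ω \ {p₀}, ∃ U : Set (Fin m → ℝ), IsOpen U ∧ p ∈ U ∧ U ⊆ Ω ∧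
         GoodFrame m U F v))) :
    ∀ x ∈ Ω, v x = u x := by
  rcases hmain with ⟨hS, hμ, hH, hfr⟩ | ⟨hS, hμ, hH, hfr⟩
  · exact eqOn_of_isolated_singular_point hm hΩopen hΩconn hF hu hv hvu hp₀ htouch hA hdiv hS hμ
      hH hfr
  · have h := eqOn_of_isolated_singular_point hm hΩopen hΩconn (F := -F) (u := -v) (v := -u) hF.neg
      hv.neg hu.neg (fun x hx => neg_le_neg (hvu x hx)) hp₀ (congrArg Neg.neg htouch.symm) hA
      (by simpa only [divFb_neg_right, neg_pos, neg_lt_zero] using hdiv.symm)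
      (by rwa [SingSet_neg]) (by rwa [SingSet_neg])
      (fun x hx => by
        rw [SingSet_neg] at hx
        rw [Hmc_neg, Hmc_neg]
        exact neg_le_neg (hH x hx))
      (fun p hp => by
        obtain ⟨U, h1, h2, h3, h4⟩ := hfr p hp
        exact ⟨U, h1, h2, h3, h4.neg⟩)
    exact fun x hx => (neg_injective (h x hx)).symm
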